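/- arXiv:2302.03588 — 6 statements merged into one kernel-verified Lean document; each statement's English description precedes it below -/
import Mathlib

section
/- Let C ⊆ X be nonempty and convex and x ∈ C. Then N_C(x) = {([γ],r) ∈ T_x X : ⟨([γ],r), ([γ^y],d(x,y))⟩ ≤ 0 for all y ∈ C}, where for y ∈ C, γ^y denotes the geodesic from x to y (and for y = x the corresponding tangent element is the origin o_x). -/
/-!
Basic convex analysis in metric spaces with bounded curvature:
common definitions (geodesics, Alexandrov angles, tangent-space elements,
normal cones, subdifferentials, CAT(κ) conditions).
-/

open Metric Real Set Filter

noncomputable section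

namespace CATPaper

/-- A geodesic of length `l` in a metric space `X`: a map `ℝ → X` that is isometric
on `[0, l]` (values outside `[0, l]` are irrelevant). -/
structure Geodesic (X : Type*) [MetricSpace X] where
  l : ℝ
  l_nonneg : 0 ≤ l
  map : ℝ → X
  isom : ∀ s ∈ Set.Icc (0:ℝ) l, ∀ t ∈ Set.Icc (0:ℝ) l, dist (map s) (map t) = |s - t|

variable {X : Type*} [MetricSpace X]

/-- The constant geodesic at a point. -/
def constGeod (x : X) : Geodesic X :=
  ⟨0, le_rfl, fun _ => x, by
    rintro s ⟨hs0, hs1⟩ t ⟨ht0, ht1⟩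
    have : s = t := by nlinarith
    simp [this]⟩

/-- `γ` is a geodesic from `x` to `y` (parametrized by arclength on `[0, d(x,y)]`). -/
def GeodesicFromTo (γ : Geodesic X) (x y : X) : Prop :=
  γ.map 0 = x ∧ γ.l = dist x y ∧ γ.map γ.l = y

/-- Every two points of `X` are joined by a geodesic. -/
def GeodesicSpace (X : Type*) [MetricSpace X] : Prop :=
  ∀ x y : X, ∃ γ : Geodesic X, GeodesicFromTo γ x y

/-- Every two points of `X` are joined by a unique geodesic segment. -/
def UniquelyGeodesic (X : Type*) [MetricSpace X] : Prop :=
  ∀ (x y : X) (γ η : Geodesic X), GeodesicFromTo γ x y → GeodesicFromTo η x y →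
    ∀ t ∈ Set.Icc (0:ℝ) (dist x y), γ.map t = η.map t

/-- The geodesic extension property around `x` with constant `R`: any geodesic between
distinct points `y, z ∈ B(x,R)` with `d(y,z) < R` extends beyond `z` to a geodesic of
length `R`. -/
def GeodExtAround (x : X) (R : ℝ) : Prop :=
  ∀ y z : X, y ∈ Metric.ball x R → z ∈ Metric.ball x R → y ≠ z → dist y z < R →
    ∃ γ : Geodesic X, γ.l = R ∧ γ.map 0 = y ∧ γ.map (dist y z) = z

/-- The (global) geodesic extension property: every nondegenerate geodesic segment is
contained in a geodesic line. -/
def GeodExtGlobal (X : Type*) [MetricSpace X] : Prop :=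
  ∀ γ : Geodesic X, 0 < γ.l → ∃ g : ℝ → X,
    (∀ s t : ℝ, dist (g s) (g t) = |s - t|) ∧ ∀ t ∈ Set.Icc (0:ℝ) γ.l, g t = γ.map t

/-- The Euclidean comparison angle at the vertex `x` of the triple `(p, x, q)`. -/
def compAngle (x p q : X) : ℝ :=
  Real.arccos ((dist x p ^ 2 + dist x q ^ 2 - dist p q ^ 2) / (2 * dist x p * dist x q))

/-- The Alexandrov angle between two geodesics issuing at the same point: the limit as
`s, t ↘ 0` of the Euclidean comparison angles (junk value if the limit does not exist). -/
def alexAngle (γ η : Geodesic X) : ℝ :=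
  limUnder ((nhdsWithin (0:ℝ) (Set.Ioi 0)) ×ˢ (nhdsWithin (0:ℝ) (Set.Ioi 0)))
    (fun p : ℝ × ℝ => compAngle (γ.map 0) (γ.map p.1) (η.map p.2))

/-- `([γ], r)` is an element of the tangent space at `x`: `γ` issues at `x`, `r ≥ 0`, and
`γ` is nonconstant unless `r = 0` (in which case `([γ], r)` is the origin `o_x`). -/
def InTangent (x : X) (γ : Geodesic X) (r : ℝ) : Prop :=
  γ.map 0 = x ∧ 0 ≤ r ∧ (r = 0 ∨ 0 < γ.l)

/-- Equality of directions `[γ] = [η]` (equivalence classes under zero Alexandrov angle;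
constant geodesics all represent the degenerate direction). -/
def DirEq (γ η : Geodesic X) : Prop :=
  (γ.l = 0 ∧ η.l = 0) ∨ (0 < γ.l ∧ 0 < η.l ∧ alexAngle γ η = 0)

/-- The scalar product `⟨([γ], r), ([η], s)⟩ = r·s·cos ∠(γ, η)` of two tangent-space
elements. -/
def tInner (γ : Geodesic X) (r : ℝ) (η : Geodesic X) (s : ℝ) : ℝ :=
  r * s * Real.cos (alexAngle γ η)

/-- The tangent-space elements `([γ], r)` and `([η], s)` are opposite to each other. -/
def TanOpposite (γ : Geodesic X) (r : ℝ) (η : Geodesic X) (s : ℝ) : Prop :=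
  (r = 0 ∧ s = 0) ∨ (r = s ∧ 0 < r ∧ alexAngle γ η = π)

/-- The metric projection of `z` onto `C`: the set of points of `C` nearest to `z`. -/
def projSet (C : Set X) (z : X) : Set X :=
  {y ∈ C | ∀ c ∈ C, dist z y ≤ dist z c}

/-- A set is convex if it contains every geodesic segment between its points. -/
def GConvex (C : Set X) : Prop :=
  ∀ γ : Geodesic X, γ.map 0 ∈ C → γ.map γ.l ∈ C → ∀ t ∈ Set.Icc (0:ℝ) γ.l, γ.map t ∈ C

/-- `([γ], r)` belongs to the normal cone of `C` at `x`: `r = 0`, or `x` is the metric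
projection onto `C` of `γ(t)` for some `t > 0`. -/
def InNormalCone (C : Set X) (x : X) (γ : Geodesic X) (r : ℝ) : Prop :=
  r = 0 ∨ ∃ t : ℝ, 0 < t ∧ t ≤ γ.l ∧ projSet C (γ.map t) = {x}

/-- The diameter `D_κ = π/√κ` of the model space `M_κ²` for `κ > 0`. -/
def Dk (κ : ℝ) : ℝ := π / Real.sqrt κ

/-- The comparison distance in the model sphere `M_κ²` of curvature `κ > 0`: the distance
from the vertex `p̄` to the point at arclength `t` along the side `q̄ r̄` of a comparison
triangle with `d(q,r) = a`, `d(p,q) = b`, `d(p,r) = c`, computed via the spherical law of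
cosines. -/
def modelCompDist (κ a b c t : ℝ) : ℝ :=
  (1 / Real.sqrt κ) * Real.arccos
    (Real.cos (Real.sqrt κ * b) * Real.cos (Real.sqrt κ * t) +
      Real.sin (Real.sqrt κ * b) * Real.sin (Real.sqrt κ * t) *
        ((Real.cos (Real.sqrt κ * c) - Real.cos (Real.sqrt κ * a) * Real.cos (Real.sqrt κ * b)) /
          (Real.sin (Real.sqrt κ * a) * Real.sin (Real.sqrt κ * b))))

/-- `X` is a `CAT(κ)` space for `κ > 0`: every two points at distance `< D_κ` are joined
by a geodesic, and every geodesic triangle of perimeter `< 2 D_κ` is no thicker than its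
comparison triangle in the model sphere `M_κ²`. -/
def IsCATK (κ : ℝ) (X : Type*) [MetricSpace X] : Prop :=
  (∀ x y : X, dist x y < Dk κ → ∃ γ : Geodesic X, GeodesicFromTo γ x y) ∧
  (∀ (p : X) (σ : Geodesic X),
    dist p (σ.map 0) + dist p (σ.map σ.l) + σ.l < 2 * Dk κ →
    ∀ t ∈ Set.Icc (0:ℝ) σ.l,
      dist p (σ.map t) ≤ modelCompDist κ σ.l (dist p (σ.map 0)) (dist p (σ.map σ.l)) t)

/-- `X` is a `CAT(0)` space: a geodesic space satisfying the `CAT(0)` comparison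
inequality `d(z, γ(t·l))² ≤ (1-t)·d(z,γ(0))² + t·d(z,γ(l))² - t(1-t)·l²`. -/
def IsCAT0 (X : Type*) [MetricSpace X] : Prop :=
  GeodesicSpace X ∧
  ∀ (z : X) (γ : Geodesic X), ∀ t ∈ Set.Icc (0:ℝ) 1,
    dist z (γ.map (t * γ.l)) ^ 2 ≤
      (1 - t) * dist z (γ.map 0) ^ 2 + t * dist z (γ.map γ.l) ^ 2 - t * (1 - t) * γ.l ^ 2

/-- The standing assumptions of the paper: `(X,d)` is a locally compact, uniquely geodesic
`CAT(κ)` space (`κ > 0`) having, around every point `x`, the geodesic extension property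
with a constant `R x < D_κ/2`. -/
structure Standing (κ : ℝ) (X : Type*) [MetricSpace X] (R : X → ℝ) : Prop where
  kpos : 0 < κ
  locComp : LocallyCompactSpace X
  cat : IsCATK κ X
  geod : GeodesicSpace X
  unique : UniquelyGeodesic X
  Rpos : ∀ x : X, 0 < R x
  Rsmall : ∀ x : X, R x < Dk κ / 2
  ext : ∀ x : X, GeodExtAround x (R x)

/-- A function `f : X → (-∞, ∞]` is convex if
`f(γ(t·l)) ≤ (1-t)·f(γ(0)) + t·f(γ(l))` along every geodesic. -/
def GConvexFn (f : X → EReal) : Prop :=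
  ∀ (γ : Geodesic X), ∀ t ∈ Set.Icc (0:ℝ) 1,
    f (γ.map (t * γ.l)) ≤ ((1 - t : ℝ) : EReal) * f (γ.map 0) + (t : EReal) * f (γ.map γ.l)

/-- The product `X × ℝ` equipped with the metric
`d₂((x₁,λ₁),(x₂,λ₂)) = √(d(x₁,x₂)² + |λ₁-λ₂|²)`. -/
abbrev XR (X : Type*) [MetricSpace X] : Type _ := WithLp 2 (X × ℝ)

/-- The point `(x, a)` of `X × ℝ`. -/
def toXR (x : X) (a : ℝ) : XR X := (WithLp.equiv 2 (X × ℝ)).symm (x, a)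

/-- The epigraph of `f : X → (-∞, ∞]`, as a subset of `X × ℝ`. -/
def epigraph (f : X → EReal) : Set (XR X) :=
  {p : XR X | f ((WithLp.equiv 2 (X × ℝ)) p).1 ≤ ((((WithLp.equiv 2 (X × ℝ)) p).2 : ℝ) : EReal)}

/-- `([γ], r) ∈ ∂f(x)`: the geodesic `σ(t) = (γ(rt/√(r²+1)), f(x) - t/√(r²+1))`,
`t ∈ [0, R₀]`, in `X × ℝ` satisfies `([σ], 1) ∈ N_{epi f}(x, f(x))`. -/
def IsSubgrad (R₀ : ℝ) (f : X → EReal) (x : X) (γ : Geodesic X) (r : ℝ) : Prop :=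
  ∃ σ : Geodesic (XR X), σ.l = R₀ ∧
    (∀ t : ℝ, σ.map t =
      toXR (γ.map (r * t / Real.sqrt (r ^ 2 + 1)))
        ((f x).toReal - t / Real.sqrt (r ^ 2 + 1))) ∧
    InNormalCone (epigraph f) (toXR x (f x).toReal) σ 1

/-- `([γ], r) ∈ ∂f(x)` in the `CAT(0)` setting, where the defining geodesic `σ` may be
taken on any interval `[0, l]`, `l > 0`. -/
def IsSubgrad0 (f : X → EReal) (x : X) (γ : Geodesic X) (r : ℝ) : Prop :=
  ∃ σ : Geodesic (XR X), 0 < σ.l ∧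
    (∀ t : ℝ, σ.map t =
      toXR (γ.map (r * t / Real.sqrt (r ^ 2 + 1)))
        ((f x).toReal - t / Real.sqrt (r ^ 2 + 1))) ∧
    InNormalCone (epigraph f) (toXR x (f x).toReal) σ 1

end CATPaper

namespace CATPaper

section Angles

variable {X : Type*} [MetricSpace X]

/-- The restriction of a geodesic to an initial segment of length `a`. -/
def Geodesic.truncate (γ : Geodesic X) (a : ℝ) (h0 : 0 ≤ a) (ha : a ≤ γ.l) : Geodesic X :=
  ⟨a, h0, γ.map, fun s hs t ht =>
    γ.isom s ⟨hs.1, hs.2.trans ha⟩ t ⟨ht.1, ht.2.trans ha⟩⟩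

lemma Geodesic.dist_zero (γ : Geodesic X) {s : ℝ} (h0 : 0 ≤ s) (hs : s ≤ γ.l) :
    dist (γ.map 0) (γ.map s) = s := by
  rw [γ.isom 0 ⟨le_rfl, γ.l_nonneg⟩ s ⟨h0, hs⟩, zero_sub, abs_neg, abs_of_nonneg h0]

/-- The cosine of the spherical comparison angle at the vertex between sides of lengths
`s` and `t` of a triangle whose third side has length `d`, for curvature `k ^ 2`. -/
def sphCos (k s t d : ℝ) : ℝ :=
  (cos (k * d) - cos (k * s) * cos (k * t)) / (sin (k * s) * sin (k * t))

/-- The cosine of the Euclidean comparison angle at the vertex between sides of lengths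
`s` and `t` of a triangle whose third side has length `d`. -/
def eucCos (s t d : ℝ) : ℝ := (s ^ 2 + t ^ 2 - d ^ 2) / (2 * s * t)

lemma sphCos_comm (k s t d : ℝ) : sphCos k s t d = sphCos k t s d := by
  simp only [sphCos, mul_comm]

lemma sin_pos_of_lt_Dk {κ s : ℝ} (hκ : 0 < κ) (h0 : 0 < s) (hs : s < Dk κ) :
    0 < sin (√κ * s) := by
  have hk : 0 < √κ := Real.sqrt_pos.2 hκ
  refine sin_pos_of_pos_of_lt_pi (by positivity) ?_
  rw [Dk, lt_div_iff₀ hk] at hs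
  linarith

lemma sphCos_le_one {κ s t d : ℝ} (hκ : 0 < κ) (hs : 0 < s) (ht : 0 < t) (hst : s + t < Dk κ)
    (hd : |s - t| ≤ d) (hd' : d ≤ s + t) : sphCos (√κ) s t d ≤ 1 := by
  have hk : 0 < √κ := Real.sqrt_pos.2 hκ
  have h1 := sin_pos_of_lt_Dk hκ hs (by linarith)
  have h2 := sin_pos_of_lt_Dk hκ ht (by linarith)
  have hπ : √κ * d ≤ π := by
    have : d < Dk κ := by linarith
    rw [Dk, lt_div_iff₀ hk] at this
    linarith
  rw [sphCos, div_le_one (by positivity)]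
  have h3 : cos (√κ * d) ≤ cos |√κ * (s - t)| := by
    refine cos_le_cos_of_nonneg_of_le_pi (abs_nonneg _) hπ ?_
    rw [abs_mul, abs_of_pos hk]
    gcongr
  rw [cos_abs, mul_sub, cos_sub] at h3
  linarith

lemma sub_dist_bounds (γ η : Geodesic X) (h : γ.map 0 = η.map 0) {s t : ℝ} (hs : 0 ≤ s)
    (hsl : s ≤ γ.l) (ht : 0 ≤ t) (htl : t ≤ η.l) :
    |s - t| ≤ dist (γ.map s) (η.map t) ∧ dist (γ.map s) (η.map t) ≤ s + t := by
  have h1 := γ.dist_zero hs hsl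
  have h2 := η.dist_zero ht htl
  rw [← h] at h2
  constructor
  · rw [abs_le]
    have h3 := dist_triangle (γ.map 0) (γ.map s) (η.map t)
    have h4 := dist_triangle_right (γ.map 0) (γ.map s) (η.map t)
    constructor <;> linarith
  · have h3 := dist_triangle_left (γ.map s) (η.map t) (γ.map 0)
    linarith

lemma sphCos_antitone_left {κ : ℝ} (hκ : 0 < κ) (hX : IsCATK κ X) (γ η : Geodesic X)
    (h : γ.map 0 = η.map 0) {s a t : ℝ} (hs : 0 < s) (hsa : s ≤ a) (ha : a ≤ γ.l)
    (ht : 0 < t) (htl : t ≤ η.l) (hat : a + t < Dk κ) :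
    sphCos (√κ) a t (dist (γ.map a) (η.map t)) ≤ sphCos (√κ) s t (dist (γ.map s) (η.map t)) := by
  have hk : 0 < √κ := Real.sqrt_pos.2 hκ
  have ha0 : 0 < a := hs.trans_le hsa
  obtain ⟨ha1, ha2⟩ := sub_dist_bounds γ η h ha0.le ha ht.le htl
  obtain ⟨hs1, hs2⟩ := sub_dist_bounds γ η h hs.le (hsa.trans ha) ht.le htl
  have hF := sphCos_le_one hκ ha0 ht hat ha1 ha2
  have sins := sin_pos_of_lt_Dk hκ hs (by linarith)
  have sint := sin_pos_of_lt_Dk hκ ht (by linarith)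
  have ht0 : dist (η.map t) (γ.map 0) = t := by
    rw [h, dist_comm, η.dist_zero ht.le htl]
  have key := hX.2 (η.map t) (γ.truncate a ha0.le ha) (by
    simp only [Geodesic.truncate, ht0, dist_comm (η.map t)] at *
    linarith) s ⟨hs.le, hsa⟩
  simp only [Geodesic.truncate, modelCompDist, ht0] at key
  rw [dist_comm (η.map t) (γ.map s), dist_comm (η.map t) (γ.map a)] at key
  set d := dist (γ.map s) (η.map t)
  set F := sphCos (√κ) a t (dist (γ.map a) (η.map t)) with hFdef
  rw [← sphCos, ← hFdef, one_div, ← div_eq_inv_mul, le_div_iff₀ hk] at key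
  set A := cos (√κ * t) * cos (√κ * s) + sin (√κ * t) * sin (√κ * s) * F with hA
  have hA1 : A ≤ 1 := by
    have : A ≤ cos (√κ * t) * cos (√κ * s) + sin (√κ * t) * sin (√κ * s) * 1 := by
      rw [hA]; gcongr
    rw [mul_one, ← cos_sub] at this
    exact this.trans (cos_le_one _)
  have hAd : A ≤ cos (√κ * d) := by
    rcases le_or_gt (-1) A with h1 | h1
    · rw [← cos_arccos h1 hA1]
      refine cos_le_cos_of_nonneg_of_le_pi (by positivity) (arccos_le_pi _) ?_
      linarith
    · exact h1.le.trans (neg_one_le_cos _)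
  rw [sphCos, le_div_iff₀ (by positivity)]
  linarith

lemma eucCos_mem_Icc {s t d : ℝ} (hs : 0 < s) (ht : 0 < t) (hd : |s - t| ≤ d)
    (hd' : d ≤ s + t) : eucCos s t d ∈ Icc (-1 : ℝ) 1 := by
  have h0 : 0 ≤ d := (abs_nonneg _).trans hd
  have h1 : (s - t) ^ 2 ≤ d ^ 2 := by
    rw [← sq_abs (s - t)]
    gcongr
  have h2 : d ^ 2 ≤ (s + t) ^ 2 := by gcongr
  rw [eucCos]
  constructor
  · rw [le_div_iff₀ (by positivity)]
    linarith
  · rw [div_le_one (by positivity)]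
    linarith

lemma one_sub_sphCos_mul_sinc {k s t d : ℝ} (hk : k ≠ 0) (hs : s ≠ 0) (ht : t ≠ 0)
    (hss : sin (k * s) ≠ 0) (hst : sin (k * t) ≠ 0) :
    (1 - sphCos k s t d) * (sinc (k * s) * sinc (k * t)) =
      (1 - eucCos s t d) * (sinc (k * (d + (s - t)) / 2) * sinc (k * (d - (s - t)) / 2)) := by
  have mul_sinc (z : ℝ) : z * sinc z = sin z := by
    rcases eq_or_ne z 0 with rfl | hz
    · simp
    · rw [sinc_of_ne_zero hz]; field_simp
  have h1 : cos (k * (s - t)) - cos (k * d) =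
      2 * sin (k * (d + (s - t)) / 2) * sin (k * (d - (s - t)) / 2) := by
    rw [cos_sub_cos, ← neg_neg (sin (k * (d - (s - t)) / 2)), ← sin_neg]
    ring_nf
  have h2 : (1 - sphCos k s t d) * (sin (k * s) * sin (k * t)) =
      2 * sin (k * (d + (s - t)) / 2) * sin (k * (d - (s - t)) / 2) := by
    rw [← h1, mul_sub k s t, cos_sub, sphCos]
    field_simp
    ring
  have h3 : (1 - eucCos s t d) * (2 * s * t) = (d + (s - t)) * (d - (s - t)) := by
    rw [eucCos]
    field_simp
    ring
  rw [← mul_sinc (k * s), ← mul_sinc (k * t), ← mul_sinc (k * (d + (s - t)) / 2),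
    ← mul_sinc (k * (d - (s - t)) / 2)] at h2
  have h4 : k ^ 2 * s * t ≠ 0 := by positivity
  apply mul_left_cancel₀ h4
  linear_combination h2 - k ^ 2 / 2 *
    (sinc (k * (d + (s - t)) / 2) * sinc (k * (d - (s - t)) / 2)) * h3

lemma eventually_mem_box {a b : ℝ} (ha : 0 < a) (hb : 0 < b) :
    ∀ᶠ p : ℝ × ℝ in nhdsWithin (0:ℝ) (Ioi 0) ×ˢ nhdsWithin (0:ℝ) (Ioi 0),
      (0 < p.1 ∧ p.1 ≤ a) ∧ (0 < p.2 ∧ p.2 ≤ b) :=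
  prod_mem_prod (Ioc_mem_nhdsGT ha) (Ioc_mem_nhdsGT hb)

lemma exists_small {D a b : ℝ} (hD : 0 < D) (ha : 0 < a) (hb : 0 < b) :
    ∃ a' b' : ℝ, 0 < a' ∧ a' ≤ a ∧ 0 < b' ∧ b' ≤ b ∧ a' + b' < D :=
  ⟨min a (D / 3), min b (D / 3), lt_min ha (by linarith), min_le_left _ _,
    lt_min hb (by linarith), min_le_left _ _, by
      have := min_le_right a (D / 3)
      have := min_le_right b (D / 3)
      linarith⟩

lemma Dk_pos {κ : ℝ} (hκ : 0 < κ) : 0 < Dk κ := div_pos pi_pos (Real.sqrt_pos.2 hκ)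

/-- Spherical comparison angles converge, and their limit bounds them from below. -/
lemma exists_tendsto_sphCos {κ : ℝ} (hκ : 0 < κ) (hX : IsCATK κ X) (γ η : Geodesic X)
    (h : γ.map 0 = η.map 0) (hγ : 0 < γ.l) (hη : 0 < η.l) :
    ∃ L : ℝ, Tendsto (fun p : ℝ × ℝ => sphCos (√κ) p.1 p.2 (dist (γ.map p.1) (η.map p.2)))
        (nhdsWithin (0:ℝ) (Ioi 0) ×ˢ nhdsWithin (0:ℝ) (Ioi 0)) (nhds L) ∧
      ∀ s t, 0 < s → s ≤ γ.l → 0 < t → t ≤ η.l → s + t < Dk κ →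
        sphCos (√κ) s t (dist (γ.map s) (η.map t)) ≤ L := by
  set F : ℝ × ℝ → ℝ := fun p => sphCos (√κ) p.1 p.2 (dist (γ.map p.1) (η.map p.2)) with hF
  set S : Set (ℝ × ℝ) :=
    {p | 0 < p.1 ∧ p.1 ≤ γ.l ∧ 0 < p.2 ∧ p.2 ≤ η.l ∧ p.1 + p.2 < Dk κ} with hS
  have mono : ∀ p ∈ S, ∀ q : ℝ × ℝ, 0 < q.1 → q.1 ≤ p.1 → 0 < q.2 → q.2 ≤ p.2 → F p ≤ F q := by
    rintro ⟨a, b⟩ ⟨ha, hal, hb, hbl, hab⟩ ⟨s, t⟩ hs hsa ht htb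
    simp only at *
    refine (sphCos_antitone_left hκ hX γ η h hs hsa hal hb hbl hab).trans ?_
    have := sphCos_antitone_left hκ hX η γ h.symm ht htb hbl hs (hsa.trans hal) (by linarith)
    rwa [sphCos_comm _ b s, sphCos_comm _ t s, dist_comm (η.map b), dist_comm (η.map t)] at this
  have hbdd : BddAbove (F '' S) := by
    refine ⟨1, ?_⟩
    rintro _ ⟨⟨s, t⟩, ⟨hs, hsl, ht, htl, hst⟩, rfl⟩
    obtain ⟨h1, h2⟩ := sub_dist_bounds γ η h hs.le hsl ht.le htl
    exact sphCos_le_one hκ hs ht hst h1 h2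
  obtain ⟨a, b, ha, hal, hb, hbl, hab⟩ := exists_small (Dk_pos hκ) hγ hη
  have hne : (F '' S).Nonempty := ⟨_, (a, b), ⟨ha, hal, hb, hbl, hab⟩, rfl⟩
  have hle : ∀ p ∈ S, F p ≤ sSup (F '' S) := fun p hp => le_csSup hbdd ⟨p, hp, rfl⟩
  refine ⟨sSup (F '' S), tendsto_order.2 ⟨fun c hc => ?_, fun c hc => ?_⟩,
    fun s t hs hsl ht htl hst => hle (s, t) ⟨hs, hsl, ht, htl, hst⟩⟩
  · obtain ⟨_, ⟨p, hp, rfl⟩, hcp⟩ := exists_lt_of_lt_csSup hne hc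
    filter_upwards [eventually_mem_box hp.1 hp.2.2.1] with q hq
    exact hcp.trans_le (mono p hp q hq.1.1 hq.1.2 hq.2.1 hq.2.2)
  · filter_upwards [eventually_mem_box ha hb] with q hq
    exact (hle q ⟨hq.1.1, hq.1.2.trans hal, hq.2.1, hq.2.2.trans hbl,
      by linarith [hq.1.2, hq.2.2]⟩).trans_lt hc

/-- Euclidean comparison angles have the same limit as spherical ones. -/
lemma tendsto_eucCos {κ L : ℝ} (hκ : 0 < κ) (γ η : Geodesic X)
    (h : γ.map 0 = η.map 0) (hγ : 0 < γ.l) (hη : 0 < η.l)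
    (hL : Tendsto (fun p : ℝ × ℝ => sphCos (√κ) p.1 p.2 (dist (γ.map p.1) (η.map p.2)))
        (nhdsWithin (0:ℝ) (Ioi 0) ×ˢ nhdsWithin (0:ℝ) (Ioi 0)) (nhds L)) :
    Tendsto (fun p : ℝ × ℝ => eucCos p.1 p.2 (dist (γ.map p.1) (η.map p.2)))
        (nhdsWithin (0:ℝ) (Ioi 0) ×ˢ nhdsWithin (0:ℝ) (Ioi 0)) (nhds L) := by
  set l := nhdsWithin (0:ℝ) (Ioi 0) ×ˢ nhdsWithin (0:ℝ) (Ioi 0) with hl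
  have hk : 0 < √κ := Real.sqrt_pos.2 hκ
  have hs : Tendsto (fun p : ℝ × ℝ => p.1) l (nhds 0) :=
    (tendsto_nhdsWithin_of_tendsto_nhds tendsto_id).comp tendsto_fst
  have ht : Tendsto (fun p : ℝ × ℝ => p.2) l (nhds 0) :=
    (tendsto_nhdsWithin_of_tendsto_nhds tendsto_id).comp tendsto_snd
  have hd : Tendsto (fun p : ℝ × ℝ => dist (γ.map p.1) (η.map p.2)) l (nhds 0) := by
    refine tendsto_of_tendsto_of_tendsto_of_le_of_le' tendsto_const_nhds
      (by simpa using hs.add ht) (Eventually.of_forall fun _ => dist_nonneg) ?_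
    filter_upwards [eventually_mem_box hγ hη] with p hp
    exact (sub_dist_bounds γ η h hp.1.1.le hp.1.2 hp.2.1.le hp.2.2).2
  have sinc_one {f : ℝ × ℝ → ℝ} (hf : Tendsto f l (nhds 0)) :
      Tendsto (fun p => sinc (f p)) l (nhds 1) := by
    have := (continuous_sinc.tendsto 0).comp hf
    rwa [sinc_zero] at this
  have hB : Tendsto (fun p : ℝ × ℝ => sinc (√κ * p.1) * sinc (√κ * p.2)) l (nhds 1) := by
    simpa using (sinc_one (by simpa using hs.const_mul (√κ))).mul
      (sinc_one (by simpa using ht.const_mul (√κ)))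
  have hA : Tendsto (fun p : ℝ × ℝ =>
      sinc (√κ * (dist (γ.map p.1) (η.map p.2) + (p.1 - p.2)) / 2) *
        sinc (√κ * (dist (γ.map p.1) (η.map p.2) - (p.1 - p.2)) / 2)) l (nhds 1) := by
    simpa using (sinc_one (by simpa using ((hd.add (hs.sub ht)).const_mul (√κ)).div_const 2)).mul
      (sinc_one (by simpa using ((hd.sub (hs.sub ht)).const_mul (√κ)).div_const 2))
  have hlim : Tendsto (fun p : ℝ × ℝ =>
      1 - (1 - sphCos (√κ) p.1 p.2 (dist (γ.map p.1) (η.map p.2))) *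
        (sinc (√κ * p.1) * sinc (√κ * p.2)) /
        (sinc (√κ * (dist (γ.map p.1) (η.map p.2) + (p.1 - p.2)) / 2) *
          sinc (√κ * (dist (γ.map p.1) (η.map p.2) - (p.1 - p.2)) / 2))) l (nhds L) := by
    simpa using (((hL.const_sub 1).mul hB).div hA one_ne_zero).const_sub 1
  refine hlim.congr' ?_
  obtain ⟨a, b, ha, -, hb, -, hab⟩ := exists_small (Dk_pos hκ) hγ hη
  filter_upwards [eventually_mem_box ha hb, hA.eventually_ne one_ne_zero] with p hp hpA
  rw [one_sub_sphCos_mul_sinc hk.ne' hp.1.1.ne' hp.2.1.ne'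
    (sin_pos_of_lt_Dk hκ hp.1.1 (by linarith [hp.1.2])).ne'
    (sin_pos_of_lt_Dk hκ hp.2.1 (by linarith [hp.2.2])).ne', mul_div_cancel_right₀ _ hpA]
  ring

/-- In a `CAT(κ)` space the cosine of the Alexandrov angle is the limit of the cosines of
the Euclidean comparison angles, and bounds those of spherical comparison angles. -/
lemma cos_alexAngle {κ : ℝ} (hκ : 0 < κ) (hX : IsCATK κ X) (γ η : Geodesic X)
    (h : γ.map 0 = η.map 0) (hγ : 0 < γ.l) (hη : 0 < η.l) :
    Tendsto (fun p : ℝ × ℝ => eucCos p.1 p.2 (dist (γ.map p.1) (η.map p.2)))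
        (nhdsWithin (0:ℝ) (Ioi 0) ×ˢ nhdsWithin (0:ℝ) (Ioi 0)) (nhds (cos (alexAngle γ η))) ∧
      ∀ s t, 0 < s → s ≤ γ.l → 0 < t → t ≤ η.l → s + t < Dk κ →
        sphCos (√κ) s t (dist (γ.map s) (η.map t)) ≤ cos (alexAngle γ η) := by
  obtain ⟨L, hL, hle⟩ := exists_tendsto_sphCos hκ hX γ η h hγ hη
  have hG := tendsto_eucCos hκ γ η h hγ hη hL
  have hmem : L ∈ Icc (-1 : ℝ) 1 := by
    refine isClosed_Icc.mem_of_tendsto hG ?_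
    filter_upwards [eventually_mem_box hγ hη] with p hp
    obtain ⟨h1, h2⟩ := sub_dist_bounds γ η h hp.1.1.le hp.1.2 hp.2.1.le hp.2.2
    exact eucCos_mem_Icc hp.1.1 hp.2.1 h1 h2
  have hα : alexAngle γ η = arccos L := by
    refine Tendsto.limUnder_eq ?_
    refine ((continuous_arccos.tendsto L).comp hG).congr' ?_
    filter_upwards [eventually_mem_box hγ hη] with p hp
    rw [compAngle, γ.dist_zero hp.1.1.le hp.1.2]
    rw [h, η.dist_zero hp.2.1.le hp.2.2]
    rfl
  rw [hα, cos_arccos hmem.1 hmem.2]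
  exact ⟨hG, hle⟩

/-- If no point of `η` is closer to `γ t` than the common starting point, then the angle
between `γ` and `η` is at least `π / 2`. -/
lemma cos_alexAngle_nonpos {κ : ℝ} (hκ : 0 < κ) (hX : IsCATK κ X) (γ η : Geodesic X)
    (h : γ.map 0 = η.map 0) (hη : 0 < η.l) {t : ℝ} (ht : 0 < t) (htl : t ≤ γ.l)
    (hmin : ∀ u ∈ Icc 0 η.l, t ≤ dist (γ.map t) (η.map u)) : cos (alexAngle γ η) ≤ 0 := by
  have hG := (cos_alexAngle hκ hX γ η h (ht.trans_le htl) hη).1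
  refine le_of_forall_pos_le_add fun ε hε => ?_
  rw [zero_add]
  have hid : Tendsto (fun s : ℝ => s) (nhdsWithin 0 (Ioi 0)) (nhdsWithin 0 (Ioi 0)) := tendsto_id
  have hmul : Tendsto (fun s : ℝ => ε * s) (nhdsWithin 0 (Ioi 0)) (nhdsWithin 0 (Ioi 0)) := by
    refine tendsto_nhdsWithin_iff.2 ⟨?_, ?_⟩
    · simpa using (tendsto_nhdsWithin_of_tendsto_nhds (tendsto_id (x := nhds (0:ℝ)))).const_mul ε
    · filter_upwards [self_mem_nhdsWithin] with s hs
      exact mul_pos hε hs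
  refine le_of_tendsto (hG.comp (hid.prodMk hmul)) ?_
  filter_upwards [Ioc_mem_nhdsGT ht, Ioc_mem_nhdsGT (show 0 < η.l / ε by positivity)]
    with s hs hs'
  have hs0 : 0 < s := hs.1
  have hεs : ε * s ≤ η.l := by
    rw [mul_comm]; exact (le_div_iff₀ hε).1 hs'.2
  have h1 := hmin (ε * s) ⟨by positivity, hεs⟩
  have h2 := dist_triangle (γ.map t) (γ.map s) (η.map (ε * s))
  rw [γ.isom t ⟨ht.le, htl⟩ s ⟨hs0.le, hs.2.trans htl⟩, abs_of_nonneg (by linarith [hs.2])] at h2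
  have h3 : s ^ 2 ≤ dist (γ.map s) (η.map (ε * s)) ^ 2 := by
    gcongr
    linarith
  simp only [Function.comp, eucCos]
  rw [div_le_iff₀ (by positivity)]
  nlinarith [sq_nonneg (ε * s)]

/-- If two geodesics form an angle of at least `π / 2`, then short initial points of the
first are strictly closer to the vertex than to nearby points of the second. -/
lemma lt_dist_of_cos_alexAngle_nonpos {κ : ℝ} (hκ : 0 < κ) (hX : IsCATK κ X) (γ η : Geodesic X)
    (h : γ.map 0 = η.map 0) (hη : 0 < η.l) (hα : cos (alexAngle γ η) ≤ 0) {s : ℝ} (hs : 0 < s)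
    (hsl : s ≤ γ.l) (hsD : s ≤ Dk κ / 4) : s < dist (γ.map s) (η.map η.l) := by
  have hk : 0 < √κ := Real.sqrt_pos.2 hκ
  have hD := Dk_pos hκ
  have hη0 := η.dist_zero η.l_nonneg le_rfl
  rcases lt_or_ge (2 * s) η.l with hlt | hle
  · have h1 := dist_triangle (γ.map 0) (γ.map s) (η.map η.l)
    rw [γ.dist_zero hs.le hsl, h, hη0] at h1
    linarith
  · have hF := ((cos_alexAngle hκ hX γ η h (hs.trans_le hsl) hη).2 s η.l hs hsl hη le_rfl
      (by linarith)).trans hα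
    have h1 := sin_pos_of_lt_Dk hκ hs (by linarith)
    have h2 := sin_pos_of_lt_Dk hκ hη (by linarith)
    rw [sphCos, div_le_iff₀ (by positivity), zero_mul] at hF
    have hksD : √κ * s ≤ π / 4 := by
      have : √κ * Dk κ = π := by rw [Dk]; field_simp
      nlinarith
    have hcs : 0 < cos (√κ * s) :=
      cos_pos_of_mem_Ioo ⟨by linarith [pi_pos, mul_pos hk hs], by linarith [pi_pos]⟩
    have hcη : cos (√κ * η.l) < 1 := by
      have := cos_lt_cos_of_nonneg_of_le_pi le_rfl
        (by nlinarith [pi_pos] : √κ * η.l ≤ π) (mul_pos hk hη)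
      rwa [cos_zero] at this
    by_contra! hcon
    have h3 : cos (√κ * s) ≤ cos (√κ * dist (γ.map s) (η.map η.l)) :=
      cos_le_cos_of_nonneg_of_le_pi (by positivity) (by linarith [pi_pos]) (by gcongr)
    nlinarith

end Angles

/-- Remark 3.3(v): `N_C(x)` consists exactly of the tangent elements `([γ],r)` such that
`⟨([γ],r), ([γ^y], d(x,y))⟩ ≤ 0` for every `y ∈ C`, where `γ^y` is the geodesic from `x`
to `y`. -/
theorem statement1 {X : Type*} [MetricSpace X] {κ : ℝ} {R : X → ℝ} (hX : Standing κ X R)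
    (C : Set X) (hCne : C.Nonempty) (hCconv : GConvex C) (x : X) (hx : x ∈ C)
    (γ : Geodesic X) (r : ℝ) (hT : InTangent x γ r) :
    InNormalCone C x γ r ↔
      ∀ y ∈ C, ∀ η : Geodesic X, GeodesicFromTo η x y → tInner γ r η (dist x y) ≤ 0 := by
  obtain ⟨hγ0, hr0, hrl⟩ := hT
  rcases hr0.eq_or_lt with rfl | hr
  · simp [InNormalCone, tInner]
  have hl : 0 < γ.l := hrl.resolve_left hr.ne'
  constructor
  · rintro (rfl | ⟨t, ht, htl, hproj⟩) y hy η ⟨hη0, hηl, hηy⟩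
    · exact absurd hr (lt_irrefl _)
    · rcases eq_or_ne x y with rfl | hxy
      · simp [tInner]
      have hd : 0 < dist x y := dist_pos.2 hxy
      have hmin : x ∈ projSet C (γ.map t) := by rw [hproj]; rfl
      have hα : cos (alexAngle γ η) ≤ 0 := by
        refine cos_alexAngle_nonpos hX.kpos hX.cat γ η (hγ0.trans hη0.symm) (by rwa [hηl]) ht htl
          fun u hu => ?_
        have h1 := hmin.2 (η.map u) (hCconv η (by rwa [hη0]) (by rwa [hηy]) u hu)
        rwa [dist_comm _ x, ← hγ0, γ.dist_zero ht.le htl] at h1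
      exact mul_nonpos_of_nonneg_of_nonpos (by positivity) hα
  · intro H
    have hD := Dk_pos hX.kpos
    obtain ⟨s, hs, hsl, hsD⟩ : ∃ s, 0 < s ∧ s ≤ γ.l ∧ s ≤ Dk κ / 4 :=
      ⟨min γ.l (Dk κ / 4), lt_min hl (by linarith), min_le_left _ _, min_le_right _ _⟩
    have hsx : dist (γ.map s) x = s := by rw [dist_comm, ← hγ0, γ.dist_zero hs.le hsl]
    have hfar : ∀ y ∈ C, y ≠ x → s < dist (γ.map s) y := by
      intro y hy hyx
      obtain ⟨η, hη⟩ := hX.geod x y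
      have hd : 0 < dist x y := dist_pos.2 hyx.symm
      have hα : cos (alexAngle γ η) ≤ 0 := by
        have := H y hy η hη
        rw [tInner] at this
        exact nonpos_of_mul_nonpos_right this (by positivity)
      have := lt_dist_of_cos_alexAngle_nonpos hX.kpos hX.cat γ η (hγ0.trans hη.1.symm)
        (by rwa [hη.2.1]) hα hs hsl hsD
      rwa [hη.2.2] at this
    refine Or.inr ⟨s, hs, hsl, Set.eq_singleton_iff_unique_mem.2 ⟨⟨hx, fun c hc => ?_⟩, ?_⟩⟩
    · rcases eq_or_ne c x with rfl | hcx
      · rfl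
      · rw [hsx]
        exact (hfar c hc hcx).le
    · rintro y ⟨hy, hymin⟩
      by_contra hyx
      have h1 := hymin x hx
      rw [hsx] at h1
      exact absurd (hfar y hy hyx) (not_lt.2 h1)

end CATPaper
end
end

section
/- Let C ⊆ X be nonempty and convex, let (x_n) be a sequence in C converging to x ∈ C, let l ∈ (0, D_κ/2), and for each n ∈ ℕ let γ_n : [0,l] → X be a nonconstant geodesic issuing at x_n with ([γ_n],1) ∈ N_C(x_n). If (γ_n) converges pointwise to a geodesic γ, then ([γ],1) ∈ N_C(x). -/
/-!
Basic convex analysis in metric spaces with bounded curvature: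
common definitions (geodesics, Alexandrov angles, tangent-space elements,
normal cones, subdifferentials, CAT(κ) conditions).
-/

open Metric Real Set Filter

noncomputable section

namespace CATPaper

/-- A function `b cos U + a sin U` with `a > 0` exceeds its value at `0` for some small `U > 0`. -/
lemma exists_lt_cos_add_sin {a : ℝ} (ha : 0 < a) (b : ℝ) {D : ℝ} (hD : 0 < D) (hDπ : D < π) :
    ∃ U, 0 < U ∧ U ≤ D / 2 ∧ b < Real.cos U * b + Real.sin U * a := by
  have hcont : Continuous fun h : ℝ => a * Real.cos h - b * Real.sin h := by fun_prop
  have hev : ∀ᶠ h in nhds (0 : ℝ), 0 < a * Real.cos h - b * Real.sin h :=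
    hcont.continuousAt.eventually_const_lt (by simpa using ha)
  have hsmall : ∀ᶠ h in nhds (0 : ℝ), h < D / 4 := eventually_lt_nhds (by positivity)
  obtain ⟨h, ⟨hpos, hlt⟩, h0⟩ :=
    (((hev.and hsmall).filter_mono nhdsWithin_le_nhds).and
      (self_mem_nhdsWithin (a := (0 : ℝ)) (s := Set.Ioi 0))).exists
  have h0 : 0 < h := h0
  refine ⟨2 * h, by linarith, by linarith, ?_⟩
  have hs : 0 < Real.sin h := Real.sin_pos_of_pos_of_lt_pi h0 (by linarith)
  rw [Real.cos_two_mul, Real.sin_two_mul, Real.cos_sq']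
  linarith [mul_pos hs hpos]

lemma le_cos_of_le_arccos {y d : ℝ} (hy : y ≤ 1) (hd0 : 0 ≤ d) (hd : d ≤ Real.arccos y) :
    y ≤ Real.cos d := by
  refine le_trans ?_ (Real.cos_le_cos_of_nonneg_of_le_pi hd0 (Real.arccos_le_pi y) hd)
  rcases le_total (-1) y with h | h
  · rw [Real.cos_arccos h hy]
  · exact h.trans (Real.neg_one_le_cos _)

lemma lt_of_le_arccos_of_cos_lt {y d s : ℝ} (hs : 0 < s) (hd0 : 0 ≤ d)
    (hd : d ≤ Real.arccos y) (hy : Real.cos s < y) : d < s := by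
  rcases le_total y 1 with h | h
  · by_contra! hsd
    have h1 := le_cos_of_le_arccos h hd0 hd
    have h2 := Real.cos_le_cos_of_nonneg_of_le_pi hs.le (hd.trans (Real.arccos_le_pi y)) hsd
    linarith
  · rw [Real.arccos_of_one_le h] at hd
    linarith

/-- In the spherical law of cosines, the cosine of the angle of a (nondegenerate) triangle
satisfying the triangle inequality is at most `1`. -/
lemma cos_sub_le_sin_mul_sin {D T E : ℝ} (hE : E ≤ π) (h : |T - D| ≤ E) :
    Real.cos E - Real.cos D * Real.cos T ≤ Real.sin D * Real.sin T := by
  have h1 := Real.cos_le_cos_of_nonneg_of_le_pi (abs_nonneg (T - D)) hE h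
  rw [Real.cos_abs, Real.cos_sub] at h1
  linarith

/-- If `γ(0) ∈ C` is a nearest point of the convex set `C` to `γ(s)` for some
`0 < s ≤ γ.l < D_κ / 2`, then it is the unique nearest point of `C` to the endpoint of `γ`. -/
lemma IsCATK.lt_dist_endpoint {X : Type*} [MetricSpace X] {κ : ℝ} (hκ : 0 < κ)
    (hcat : IsCATK κ X) {C : Set X} (hC : GConvex C) (γ : Geodesic X) (h0 : γ.map 0 ∈ C)
    (hl : γ.l < Dk κ / 2) {s : ℝ} (hs : 0 < s) (hsl : s ≤ γ.l)
    (hnear : ∀ c ∈ C, s ≤ dist (γ.map s) c) {c : X} (hc : c ∈ C) (hne : c ≠ γ.map 0) :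
    γ.l < dist (γ.map γ.l) c := by
  by_contra! hle
  have hk : 0 < Real.sqrt κ := Real.sqrt_pos.2 hκ
  have hl0 : 0 < γ.l := hs.trans_le hsl
  have hqx : dist (γ.map γ.l) (γ.map 0) = γ.l := by
    rw [γ.isom _ ⟨hl0.le, le_rfl⟩ _ ⟨le_rfl, hl0.le⟩, sub_zero, abs_of_pos hl0]
  have hd0 : 0 < dist (γ.map 0) c := dist_pos.2 hne.symm
  have hd2 : dist (γ.map 0) c ≤ 2 * γ.l := by
    have := dist_triangle_left (γ.map 0) c (γ.map γ.l)
    linarith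
  obtain ⟨σ, hσ0, hσl, hσe⟩ := hcat.1 (γ.map 0) c (by linarith)
  have hDk : Real.sqrt κ * Dk κ = π := by
    unfold Dk
    field_simp
  set k := Real.sqrt κ with hk_def
  set l := γ.l with hl_def
  set q := γ.map l with hq_def
  set d := dist (γ.map 0) c with hd_def
  set e := dist q c with he_def
  have he0 : 0 ≤ e := dist_nonneg
  have hT : k * l < π / 2 := by nlinarith
  have hT0 : 0 < k * l := by positivity
  have hS0 : 0 < k * s := by positivity
  have hST : k * s ≤ k * l := by gcongr
  have hD0 : 0 < k * d := by positivity
  have hDπ : k * d < π := by nlinarith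
  have hET : k * e ≤ k * l := by gcongr
  have hE0 : 0 ≤ k * e := by positivity
  have hsD : 0 < Real.sin (k * d) := Real.sin_pos_of_pos_of_lt_pi hD0 hDπ
  have hsT : 0 < Real.sin (k * l) := Real.sin_pos_of_pos_of_lt_pi hT0 (by linarith)
  have hsS : 0 < Real.sin (k * s) := Real.sin_pos_of_pos_of_lt_pi hS0 (by linarith)
  have hcT : 0 < Real.cos (k * l) := Real.cos_pos_of_mem_Ioo ⟨by linarith, by linarith⟩
  have hcET : Real.cos (k * l) ≤ Real.cos (k * e) :=
    Real.cos_le_cos_of_nonneg_of_le_pi hE0 (by linarith) hET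
  have hcD : Real.cos (k * d) < 1 := by
    simpa using Real.cos_lt_cos_of_nonneg_of_le_pi le_rfl hDπ.le hD0
  set A := (Real.cos (k * e) - Real.cos (k * d) * Real.cos (k * l)) /
    (Real.sin (k * d) * Real.sin (k * l)) with hA_def
  have hA0 : 0 < A := by
    apply div_pos _ (mul_pos hsD hsT)
    nlinarith
  have hA1 : A ≤ 1 := by
    rw [hA_def, div_le_one (mul_pos hsD hsT)]
    apply cos_sub_le_sin_mul_sin (by linarith)
    rw [← mul_sub, abs_mul, abs_of_pos hk]
    gcongr
    rw [abs_le]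
    have h1 := dist_triangle_left (γ.map 0) c q
    have h2 := dist_triangle_right q (γ.map 0) c
    constructor <;> linarith
  obtain ⟨U, hU0, hUD, hU⟩ :=
    exists_lt_cos_add_sin (mul_pos hsS hA0) (Real.cos (k * s)) hD0 hDπ
  obtain ⟨u, rfl⟩ : ∃ u, U = k * u := ⟨U / k, by field_simp⟩
  have hu0 : 0 < u := pos_of_mul_pos_right hU0 hk.le
  have hud : u ≤ d / 2 := le_of_mul_le_mul_left (by linarith) hk
  have humem : u ∈ Set.Icc 0 σ.l := ⟨hu0.le, by linarith⟩
  have hsU : 0 < Real.sin (k * u) := Real.sin_pos_of_pos_of_lt_pi hU0 (by linarith)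
  set m := σ.map u with hm_def
  have hmC : m ∈ C := hC σ (by rwa [hσ0]) (by rwa [hσe]) u humem
  have hmx : dist m (γ.map 0) = u := by
    rw [← hσ0, σ.isom u humem 0 ⟨le_rfl, σ.l_nonneg⟩, sub_zero, abs_of_pos hu0]
  have hqm : Real.cos (k * u) * Real.cos (k * l) + Real.sin (k * l) * Real.sin (k * u) * A
      ≤ Real.cos (k * dist m q) := by
    have h := hcat.2 q σ (by rw [hσ0, hσe, hσl, hqx]; linarith) u humem
    rw [hσ0, hσe, hσl, hqx] at h
    unfold modelCompDist at h
    rw [one_div_mul_eq_div, le_div_iff₀' hk, dist_comm q] at h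
    refine le_trans (le_of_eq (by ring)) (le_cos_of_le_arccos ?_ (by positivity) h)
    have h1 : Real.cos (k * l) * Real.cos (k * u) + Real.sin (k * l) * Real.sin (k * u) ≤ 1 := by
      rw [← Real.cos_sub]
      exact Real.cos_le_one _
    nlinarith [mul_le_mul_of_nonneg_left hA1 (mul_pos hsT hsU).le]
  have hlt : dist m (γ.map s) < s := by
    have hmq := dist_triangle m (γ.map 0) q
    rw [hmx, dist_comm (γ.map 0) q, hqx] at hmq
    have h := hcat.2 m γ (by rw [hmx]; linarith) s ⟨hs.le, hsl⟩
    rw [hmx] at h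
    unfold modelCompDist at h
    rw [one_div_mul_eq_div, le_div_iff₀' hk] at h
    refine lt_of_mul_lt_mul_left (lt_of_le_arccos_of_cos_lt hS0 (by positivity) h
      (hU.trans_le ?_)) hk.le
    have hA : A ≤ (Real.cos (k * dist m q) - Real.cos (k * l) * Real.cos (k * u)) /
        (Real.sin (k * l) * Real.sin (k * u)) := by
      rw [le_div_iff₀ (mul_pos hsT hsU)]
      linarith
    have := mul_le_mul_of_nonneg_left hA (mul_pos hsU hsS).le
    linarith
  have := hnear m hmC
  rw [dist_comm] at this
  linarith

/-- Remark 3.3(vi): normal cones are closed under pointwise limits of unit normals along a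
sequence `x_n → x` in `C`. -/
theorem statement2 {X : Type*} [MetricSpace X] {κ : ℝ} {R : X → ℝ} (hX : Standing κ X R)
    (C : Set X) (hCne : C.Nonempty) (hCconv : GConvex C)
    (x : X) (hx : x ∈ C) (xs : ℕ → X) (hxs : ∀ n, xs n ∈ C)
    (hlim : Filter.Tendsto xs Filter.atTop (nhds x))
    (l : ℝ) (hl0 : 0 < l) (hl : l < Dk κ / 2)
    (γs : ℕ → Geodesic X) (hlen : ∀ n, (γs n).l = l) (hstart : ∀ n, (γs n).map 0 = xs n)
    (hnc : ∀ n, InNormalCone C (xs n) (γs n) 1)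
    (γ : Geodesic X) (hγl : γ.l = l)
    (hptwise : ∀ t ∈ Set.Icc (0:ℝ) l,
      Filter.Tendsto (fun n => (γs n).map t) Filter.atTop (nhds (γ.map t))) :
    InNormalCone C x γ 1 := by
  have hl' : l ∈ Set.Icc (0 : ℝ) l := ⟨hl0.le, le_rfl⟩
  have h0' : (0 : ℝ) ∈ Set.Icc (0 : ℝ) l := ⟨le_rfl, hl0.le⟩
  have hγ0 : γ.map 0 = x :=
    tendsto_nhds_unique (by simpa only [hstart] using hptwise 0 h0') hlim
  have hfar : ∀ n, ∀ c ∈ C, l ≤ dist ((γs n).map l) c := by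
    intro n c hc
    obtain h | ⟨s, hs0, hsl, hproj⟩ := hnc n
    · exact absurd h one_ne_zero
    have hx_near : xs n ∈ projSet C ((γs n).map s) := hproj ▸ Set.mem_singleton _
    by_cases hcx : c = xs n
    · rw [hcx, ← hstart n, (γs n).isom l (by rwa [hlen n]) 0 (by rwa [hlen n]), sub_zero,
        abs_of_pos hl0]
    · have hsx : dist ((γs n).map s) (xs n) = s := by
        rw [← hstart n, (γs n).isom s ⟨hs0.le, hsl⟩ 0 ⟨le_rfl, (γs n).l_nonneg⟩, sub_zero,
          abs_of_pos hs0]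
      have h := hX.cat.lt_dist_endpoint hX.kpos hCconv (γs n) (by rw [hstart n]; exact hxs n)
        (by rwa [hlen n]) hs0 hsl (fun c' hc' => hsx.symm.le.trans (hx_near.2 c' hc')) hc
        (by rwa [hstart n])
      rw [hlen n] at h
      exact h.le
  have hnear : ∀ c ∈ C, l ≤ dist (γ.map l) c := fun c hc =>
    ge_of_tendsto' ((hptwise l hl').dist tendsto_const_nhds) fun n => hfar n c hc
  have hlx : dist (γ.map l) x = l := by
    rw [← hγ0, γ.isom l (by rwa [hγl]) 0 (by rwa [hγl]), sub_zero, abs_of_pos hl0]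
  refine Or.inr ⟨l, hl0, hγl.ge, Set.eq_singleton_iff_unique_mem.2
    ⟨⟨hx, fun c hc => hlx.le.trans (hnear c hc)⟩, fun c hc => ?_⟩⟩
  by_contra hcx
  have h := hX.cat.lt_dist_endpoint hX.kpos hCconv γ (by rwa [hγ0]) (by rwa [hγl]) hl0 hγl.ge
    hnear hc.1 (by rwa [hγ0])
  have h' := hc.2 x hx
  rw [hγl] at h
  linarith

end CATPaper
end
end

section
/- Let C ⊆ X be nonempty and convex and x ∈ C. Then: (i) if x belongs to the interior of C, then N_C(x) = {o_x}; (ii) if N_C(x) = {o_x}, then x belongs to the interior of the closure of C. -/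
/-!
Basic convex analysis in metric spaces with bounded curvature:
common definitions (geodesics, Alexandrov angles, tangent-space elements,
normal cones, subdifferentials, CAT(κ) conditions).
-/

open Metric Real Set Filter

noncomputable section

namespace CATPaper

section

variable {X : Type*} [MetricSpace X]

/-- The spherical comparison inequality, with the denominators of the law of cosines cleared. -/
theorem sphere_comparison {A B C T D : ℝ} (hT : 0 ≤ T) (hTA : T ≤ A) (hA : A < π / 2)
    (hB0 : 0 ≤ B) (hB : B < π / 2) (hC : C < π / 2) (hAB : A - B ≤ C) (hBA : B - A ≤ C)
    (hCAB : C ≤ A + B) (hD0 : 0 ≤ D)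
    (hD : D ≤ arccos (cos B * cos T + sin B * sin T *
      ((cos C - cos A * cos B) / (sin A * sin B)))) :
    sin (A - T) * cos B + sin T * cos C ≤ sin A * cos D := by
  have hpi := Real.pi_pos
  rcases (hT.trans hTA).eq_or_lt with hA0 | hA0
  · have hT0 : T = 0 := by linarith
    simp [← hA0, hT0]
  have hsA : 0 < sin A := sin_pos_of_pos_of_lt_pi hA0 (by linarith)
  have hsT : 0 ≤ sin T := sin_nonneg_of_nonneg_of_le_pi hT (by linarith)
  have hDpi : D ≤ π := hD.trans (arccos_le_pi _)
  rcases hB0.eq_or_lt with hB0' | hB0'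
  · have hCA : C = A := by linarith
    subst hB0'
    simp only [cos_zero, sin_zero, one_mul, zero_mul, add_zero, mul_one] at hD ⊢
    rw [arccos_cos hT (by linarith)] at hD
    have hcos : cos T ≤ cos D := cos_le_cos_of_nonneg_of_le_pi hD0 (by linarith) hD
    rw [hCA, sin_sub]
    nlinarith
  have hsB : 0 < sin B := sin_pos_of_pos_of_lt_pi hB0' (by linarith)
  set Y := cos B * cos T + sin B * sin T * ((cos C - cos A * cos B) / (sin A * sin B)) with hY
  have hAY : sin A * Y = sin (A - T) * cos B + sin T * cos C := by
    rw [hY, sin_sub]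
    field_simp
    ring
  have hcosC : cos C ≤ cos (A - B) := by
    rw [← cos_abs (A - B)]
    exact cos_le_cos_of_nonneg_of_le_pi (abs_nonneg _) (by linarith)
      (abs_le.2 ⟨by linarith, hAB⟩)
  have hY1 : Y ≤ 1 := by
    have h1 : sin A * Y ≤ sin A * cos (T - B) := by
      have h2 : sin (A - T) * cos B + sin T * cos (A - B) = sin A * cos (T - B) := by
        rw [sin_sub, cos_sub, cos_sub]
        ring
      rw [hAY, ← h2]
      nlinarith
    exact (le_of_mul_le_mul_left h1 hsA).trans (cos_le_one _)
  rw [← hAY]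
  refine mul_le_mul_of_nonneg_left ?_ hsA.le
  by_cases hYm : -1 ≤ Y
  · rw [← cos_arccos hYm hY1]
    exact cos_le_cos_of_nonneg_of_le_pi hD0 (arccos_le_pi _) hD
  · linarith [neg_one_le_cos D]

/-- The `CAT(κ)` inequality for triangles with sides shorter than `D_κ / 2`, in terms of sines
and cosines. -/
theorem IsCATK.sin_mul_cos_le {κ : ℝ} (hκ : 0 < κ) (h : IsCATK κ X) (p : X) (σ : Geodesic X)
    (ha : √κ * σ.l < π / 2) (hb : √κ * dist p (σ.map 0) < π / 2)
    (hc : √κ * dist p (σ.map σ.l) < π / 2) {t : ℝ} (ht : t ∈ Set.Icc 0 σ.l) :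
    sin (√κ * σ.l - √κ * t) * cos (√κ * dist p (σ.map 0)) +
        sin (√κ * t) * cos (√κ * dist p (σ.map σ.l)) ≤
      sin (√κ * σ.l) * cos (√κ * dist p (σ.map t)) := by
  have hk : 0 < √κ := Real.sqrt_pos.2 hκ
  have hpi := Real.pi_pos
  have hl : dist (σ.map 0) (σ.map σ.l) = σ.l := by
    rw [σ.isom 0 ⟨le_rfl, σ.l_nonneg⟩ _ ⟨σ.l_nonneg, le_rfl⟩, zero_sub, abs_neg,
      abs_of_nonneg σ.l_nonneg]
  have h1 : σ.l ≤ dist p (σ.map 0) + dist p (σ.map σ.l) :=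
    hl.symm.le.trans (dist_triangle_left _ _ _)
  have h2 := dist_triangle p (σ.map 0) (σ.map σ.l)
  have h3 := dist_triangle_right p (σ.map 0) (σ.map σ.l)
  rw [hl] at h2 h3
  have hper : dist p (σ.map 0) + dist p (σ.map σ.l) + σ.l < 2 * Dk κ := by
    rw [Dk, ← mul_div_assoc, lt_div_iff₀ hk]
    nlinarith
  have hcat := h.2 p σ hper t ht
  refine sphere_comparison (mul_nonneg hk.le ht.1) (mul_le_mul_of_nonneg_left ht.2 hk.le) ha
    (by positivity) hb hc ?_ ?_ ?_ (by positivity) ?_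
  · nlinarith
  · nlinarith
  · nlinarith
  · rw [modelCompDist, one_div, inv_mul_eq_div, le_div_iff₀ hk] at hcat
    rwa [mul_comm]

/-- First-order consequence of the comparison inequalities used in `le_dist_of_extension`. -/
theorem cos_le_of_forall_small {a ρ s e : ℝ} (ha : 0 < a) (hs : 0 < sin s)
    (h : ∀ u, 0 < u → u < a → sin a * sin (ρ - s) * cos u +
      sin s * (sin (a - u) * cos ρ + sin u * cos e) ≤ sin a * (sin ρ * cos s)) :
    cos e ≤ cos a * cos ρ := by
  have hlim : ∀ᶠ u in nhdsWithin (0 : ℝ) (Ioi 0),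
      sin s * (cos e - cos a * cos ρ) * cos (u / 2) ≤ sin a * (sin ρ * cos s) * sin (u / 2) := by
    filter_upwards [Ioo_mem_nhdsGT (show (0 : ℝ) < min a π from lt_min ha Real.pi_pos)]
      with u hu
    have hu0 := hu.1
    have hv : 0 < sin (u / 2) := sin_pos_of_pos_of_lt_pi (by linarith)
      (by linarith [hu.2, min_le_right a π])
    have hu' := h u hu0 (hu.2.trans_le (min_le_left _ _))
    have e1 : sin u = 2 * sin (u / 2) * cos (u / 2) := by
      rw [← sin_two_mul]; ring_nf
    have e2 : cos u = 1 - 2 * sin (u / 2) ^ 2 := by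
      have : cos u = cos (2 * (u / 2)) := by ring_nf
      rw [this, cos_two_mul, cos_sq']; ring
    rw [sin_sub, sin_sub, e1, e2] at hu'
    refine le_of_mul_le_mul_left ?_ (show 0 < 2 * sin (u / 2) by positivity)
    linarith
  have hc1 : Tendsto (fun u : ℝ => sin s * (cos e - cos a * cos ρ) * cos (u / 2))
      (nhdsWithin (0 : ℝ) (Ioi 0)) (nhds (sin s * (cos e - cos a * cos ρ) * cos (0 / 2))) :=
    (Continuous.tendsto (by fun_prop) 0).mono_left nhdsWithin_le_nhds
  have hc2 : Tendsto (fun u : ℝ => sin a * (sin ρ * cos s) * sin (u / 2))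
      (nhdsWithin (0 : ℝ) (Ioi 0)) (nhds (sin a * (sin ρ * cos s) * sin (0 / 2))) :=
    (Continuous.tendsto (by fun_prop) 0).mono_left nhdsWithin_le_nhds
  have := le_of_tendsto_of_tendsto hc1 hc2 hlim
  simp only [zero_div, cos_zero, sin_zero, mul_one, mul_zero] at this
  nlinarith

/-- If `p` is nearest to `γ(s)` in the closure of the convex set `C`, where `γ` issues at `p`,
then no point of `C` is closer to `γ(ρ)` than `p`, for small `ρ ≥ s`. -/
theorem le_dist_of_extension {κ : ℝ} (hκ : 0 < κ) (h : IsCATK κ X) (hg : GeodesicSpace X)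
    {C : Set X} (hC : GConvex C) (γ : Geodesic X) {s : ℝ} (hs : 0 < s) (hsl : s ≤ γ.l)
    (hl : √κ * γ.l < π / 8) (hp : γ.map 0 ∈ closure C)
    (hnear : ∀ q ∈ C, s ≤ dist (γ.map s) q) {c : X} (hc : c ∈ C) :
    γ.l ≤ dist (γ.map γ.l) c := by
  by_contra! hlt
  have hk : 0 < √κ := Real.sqrt_pos.2 hκ
  have hpi := Real.pi_pos
  set k := √κ with hkdef
  set ρ := γ.l with hρ
  set p := γ.map 0 with hpdef
  set y := γ.map s with hy
  set z := γ.map ρ with hz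
  have hρ0 : 0 < ρ := hs.trans_le hsl
  have small : ∀ d, d < 4 * ρ → k * d < π / 2 := by
    intro d hd
    have := mul_lt_mul_of_pos_left hd hk
    linarith
  have hpz : dist z p = ρ := by
    rw [hz, hpdef, γ.isom ρ ⟨hρ0.le, le_rfl⟩ 0 ⟨le_rfl, hρ0.le⟩, sub_zero, abs_of_pos hρ0]
  have ha0 : 0 < dist p c := by
    have := dist_triangle z c p
    rw [hpz, dist_comm c p] at this
    linarith
  have ha2 : dist p c < 2 * ρ := by
    have := dist_triangle_left p c z
    linarith
  obtain ⟨q, hqC, hq⟩ := mem_closure_iff_seq_limit.1 hp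
  have hqp : Tendsto (fun n => dist p (q n)) atTop (nhds 0) := by
    simpa [dist_self] using (tendsto_const_nhds (x := p)).dist hq
  have hqz : Tendsto (fun n => dist z (q n)) atTop (nhds ρ) := by
    simpa [hpz] using (tendsto_const_nhds (x := z)).dist hq
  have hqc : Tendsto (fun n => dist (q n) c) atTop (nhds (dist p c)) :=
    hq.dist tendsto_const_nhds
  have key : cos (k * dist z c) ≤ cos (k * dist p c) * cos (k * ρ) := by
    refine cos_le_of_forall_small (s := k * s) (mul_pos hk ha0) 
      (sin_pos_of_pos_of_lt_pi (mul_pos hk hs) (by linarith [small s (by linarith)])) ?_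
    intro u' hu0' hua'
    obtain ⟨u, rfl⟩ : ∃ u, u' = k * u := ⟨u' / k, by field_simp⟩
    have hu0 : 0 < u := pos_of_mul_pos_right hu0' hk.le
    have hua : u < dist p c := lt_of_mul_lt_mul_left hua' hk.le
    have hev : ∀ᶠ n in atTop,
        sin (k * dist (q n) c) * sin (k * ρ - k * s) * cos (k * (u + dist p (q n))) +
          sin (k * s) * (sin (k * dist (q n) c - k * u) * cos (k * dist z (q n)) +
            sin (k * u) * cos (k * dist z c)) ≤
        sin (k * dist (q n) c) * (sin (k * ρ) * cos (k * s)) := by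
      filter_upwards [hqc.eventually (lt_mem_nhds hua), hqc.eventually (gt_mem_nhds ha2),
        hqz.eventually (gt_mem_nhds (show ρ < 2 * ρ by linarith)),
        hqp.eventually (gt_mem_nhds hρ0)] with n h1 h2 h3 h4
      obtain ⟨σ, hσ0, hσl, hσ1⟩ := hg (q n) c
      have hu : u ∈ Set.Icc 0 σ.l := ⟨hu0.le, by rw [hσl]; exact h1.le⟩
      have hwC : σ.map u ∈ C := hC σ (by rw [hσ0]; exact hqC n) (by rw [hσ1]; exact hc) u hu
      have hwq : dist (q n) (σ.map u) = u := by
        rw [← hσ0, σ.isom 0 ⟨le_rfl, σ.l_nonneg⟩ u hu, zero_sub, abs_neg, abs_of_pos hu0]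
      have hc1 := h.sin_mul_cos_le hκ z σ (small _ (by linarith))
        (small _ (by rw [hσ0]; linarith)) (small _ (by rw [hσ1]; linarith)) hu
      rw [hσ0, hσ1, hσl, ← hkdef] at hc1
      have hwp : dist (σ.map u) p ≤ u + dist p (q n) := by
        have := dist_triangle p (q n) (σ.map u)
        rw [dist_comm]; linarith
      have hwz : dist (σ.map u) z ≤ dist (σ.map u) p + ρ := by
        rw [← hpz, dist_comm z p]; exact dist_triangle _ _ _
      have hc2 := h.sin_mul_cos_le hκ (σ.map u) γ (by linarith)
        (small _ (by linarith)) (small _ (by linarith)) ⟨hs.le, hsl⟩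
      rw [← hpdef, ← hz, ← hy, ← hkdef, ← hρ, dist_comm _ z, dist_comm _ y] at hc2
      have hys := hnear _ hwC
      have hyw : dist y (σ.map u) ≤ s + (u + dist p (q n)) := by
        have h5 := dist_triangle y p (σ.map u)
        have h6 : dist y p = s := by
          rw [hy, hpdef, γ.isom s ⟨hs.le, hsl⟩ 0 ⟨le_rfl, hρ0.le⟩, sub_zero, abs_of_pos hs]
        rw [dist_comm p] at h5
        linarith
      have hcos1 : cos (k * dist y (σ.map u)) ≤ cos (k * s) :=
        cos_le_cos_of_nonneg_of_le_pi (by positivity) (by linarith [small _ (hyw.trans_lt (by linarith))])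
          (mul_le_mul_of_nonneg_left hys hk.le)
      have hcos2 : cos (k * (u + dist p (q n))) ≤ cos (k * dist (σ.map u) p) :=
        cos_le_cos_of_nonneg_of_le_pi (by positivity)
          (by linarith [small (u + dist p (q n)) (by linarith)])
          (mul_le_mul_of_nonneg_left hwp hk.le)
      have hsa : 0 ≤ sin (k * dist (q n) c) :=
        sin_nonneg_of_nonneg_of_le_pi (by positivity)
          (by linarith [small (dist (q n) c) (by linarith)])
      have hss : 0 ≤ sin (k * s) :=
        sin_nonneg_of_nonneg_of_le_pi (by positivity) (by linarith [small s (by linarith)])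
      have hsρ : 0 ≤ sin (k * ρ) :=
        sin_nonneg_of_nonneg_of_le_pi (by positivity) (by linarith)
      have hsρs : 0 ≤ sin (k * ρ - k * s) :=
        sin_nonneg_of_nonneg_of_le_pi
          (by linarith [mul_le_mul_of_nonneg_left hsl hk.le])
          (by linarith [mul_pos hk hs])
      have m1 := mul_le_mul_of_nonneg_left hc1 hss
      have m2 := mul_le_mul_of_nonneg_left hc2 hsa
      have m3 := mul_le_mul_of_nonneg_left hcos1 (mul_nonneg hsa hsρ)
      have m4 := mul_le_mul_of_nonneg_left hcos2 (mul_nonneg hsa hsρs)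
      linarith
    have tsin : ∀ {f : ℕ → ℝ} {l : ℝ}, Tendsto f atTop (nhds l) →
        Tendsto (fun n => sin (f n)) atTop (nhds (sin l)) := (continuous_sin.tendsto _).comp
    have tcos : ∀ {f : ℕ → ℝ} {l : ℝ}, Tendsto f atTop (nhds l) →
        Tendsto (fun n => cos (f n)) atTop (nhds (cos l)) := (continuous_cos.tendsto _).comp
    have hL : Tendsto (fun n =>
        sin (k * dist (q n) c) * sin (k * ρ - k * s) * cos (k * (u + dist p (q n))) +
          sin (k * s) * (sin (k * dist (q n) c - k * u) * cos (k * dist z (q n)) +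
            sin (k * u) * cos (k * dist z c))) atTop (nhds
        (sin (k * dist p c) * sin (k * ρ - k * s) * cos (k * (u + 0)) +
          sin (k * s) * (sin (k * dist p c - k * u) * cos (k * ρ) +
            sin (k * u) * cos (k * dist z c)))) :=
      (((tsin (hqc.const_mul k)).mul_const _).mul (tcos ((hqp.const_add u).const_mul k))).add
        ((((tsin ((hqc.const_mul k).sub_const _)).mul (tcos (hqz.const_mul k))).add_const
          _).const_mul _)
    have hR : Tendsto (fun n => sin (k * dist (q n) c) * (sin (k * ρ) * cos (k * s))) atTop
        (nhds (sin (k * dist p c) * (sin (k * ρ) * cos (k * s)))) :=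
      (tsin (hqc.const_mul k)).mul_const _
    simpa using le_of_tendsto_of_tendsto hL hR hev
  have hlt' : cos (k * ρ) < cos (k * dist z c) :=
    cos_lt_cos_of_nonneg_of_le_pi (by positivity) (by linarith) (mul_lt_mul_of_pos_left hlt hk)
  have hcρ : 0 < cos (k * ρ) := cos_pos_of_mem_Ioo ⟨by linarith [mul_pos hk hρ0], by linarith⟩
  nlinarith [cos_le_one (k * dist p c)]

/-- A nearest point of a convex set to a point at distance less than `D_κ / 8` is unique. -/
theorem projSet_eq_singleton {κ : ℝ} (hκ : 0 < κ) (h : IsCATK κ X) (hg : GeodesicSpace X)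
    {C : Set X} (hC : GConvex C) {x z : X} (hx : x ∈ C) (hzx : √κ * dist z x < π / 8)
    (hnear : ∀ c ∈ C, dist z x ≤ dist z c) : projSet C z = {x} := by
  have hk : 0 < √κ := Real.sqrt_pos.2 hκ
  have hpi := Real.pi_pos
  refine Set.eq_singleton_iff_unique_mem.2 ⟨⟨hx, hnear⟩, ?_⟩
  rintro c ⟨hcC, hc⟩
  by_contra hne
  have hdc : dist z c = dist z x := le_antisymm (hc x hx) (hnear c hcC)
  obtain ⟨σ, hσ0, hσl, hσ1⟩ := hg x c
  have hl0 : 0 < σ.l := by rw [hσl]; exact dist_pos.2 (Ne.symm hne)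
  have hl2 : σ.l ≤ 2 * dist z x := by
    have := dist_triangle_left x c z
    rw [hσl]; linarith
  have hm : σ.l / 2 ∈ Set.Icc 0 σ.l := ⟨by linarith, by linarith⟩
  have hmC : σ.map (σ.l / 2) ∈ C := hC σ (by rwa [hσ0]) (by rwa [hσ1]) _ hm
  have hcat := h.sin_mul_cos_le hκ z σ (by nlinarith) (by rw [hσ0]; linarith)
    (by rw [hσ1, hdc]; linarith) hm
  rw [hσ0, hσ1, hdc] at hcat
  have hmx := hnear _ hmC
  have hmz : dist z (σ.map (σ.l / 2)) ≤ dist z x + σ.l / 2 := by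
    have h1 := dist_triangle z x (σ.map (σ.l / 2))
    have h2 : dist x (σ.map (σ.l / 2)) = σ.l / 2 := by
      rw [← hσ0, σ.isom 0 ⟨le_rfl, hl0.le⟩ _ hm, zero_sub, abs_neg, abs_of_pos (by linarith)]
    linarith
  have hcos : cos (√κ * dist z (σ.map (σ.l / 2))) ≤ cos (√κ * dist z x) :=
    cos_le_cos_of_nonneg_of_le_pi (by positivity) (by nlinarith)
      (mul_le_mul_of_nonneg_left hmx hk.le)
  have hzx0 : 0 < cos (√κ * dist z x) :=
    cos_pos_of_mem_Ioo ⟨by nlinarith [mul_nonneg hk.le (dist_nonneg (x := z) (y := x))],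
      by linarith⟩
  have hsl : √κ * σ.l = 2 * (√κ * (σ.l / 2)) := by ring
  have hv0 : 0 < √κ * (σ.l / 2) := by positivity
  have hsin : 0 < sin (√κ * (σ.l / 2)) := sin_pos_of_pos_of_lt_pi hv0 (by nlinarith)
  have hcos1 : cos (√κ * (σ.l / 2)) < 1 := by
    rw [← cos_zero]
    exact cos_lt_cos_of_nonneg_of_le_pi le_rfl (by nlinarith) hv0
  have hcos0 : 0 < cos (√κ * (σ.l / 2)) := cos_pos_of_mem_Ioo ⟨by nlinarith, by nlinarith⟩
  rw [hsl, show 2 * (√κ * (σ.l / 2)) - √κ * (σ.l / 2) = √κ * (σ.l / 2) by ring,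
    sin_two_mul] at hcat
  have h1 : cos (√κ * dist z x) ≤
      cos (√κ * (σ.l / 2)) * cos (√κ * dist z (σ.map (σ.l / 2))) := by
    refine le_of_mul_le_mul_left ?_ (show 0 < 2 * sin (√κ * (σ.l / 2)) by positivity)
    linarith
  nlinarith

/-- A geodesic restricted to an initial segment. -/
def Geodesic.restrict (γ : Geodesic X) (ρ : ℝ) (h0 : 0 ≤ ρ) (h : ρ ≤ γ.l) : Geodesic X :=
  ⟨ρ, h0, γ.map, fun s hs t ht => γ.isom s ⟨hs.1, hs.2.trans h⟩ t ⟨ht.1, ht.2.trans h⟩⟩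

/-- Close to a point of `C` outside the interior of its closure there are boundary points of the
closure with normal geodesics of a definite length. -/
theorem exists_far_point {κ : ℝ} (hκ : 0 < κ) (h : IsCATK κ X) (hg : GeodesicSpace X)
    {C : Set X} (hC : GConvex C) {x : X} (hx : x ∈ C) {R₀ ρ r ε : ℝ} (hext : GeodExtAround x R₀)
    (hρR : ρ ≤ R₀) (hρk : √κ * ρ < π / 8) (hr : IsCompact (closedBall x r))
    (hρr : ρ ≤ r) (hxC : x ∉ interior (closure C)) (hε : 0 < ε) (hερ : 2 * ε ≤ ρ) :
    ∃ z, |dist z x - ρ| ≤ 2 * ε ∧ ∀ c ∈ C, ρ ≤ dist z c := by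
  obtain ⟨y, hyx, hyC⟩ : ∃ y ∈ ball x ε, y ∉ closure C := by
    by_contra! hcon
    exact hxC (mem_interior_iff_mem_nhds.2 (mem_of_superset (ball_mem_nhds x hε) hcon))
  rw [mem_ball] at hyx
  have hρ0 : 0 < ρ := by linarith
  obtain ⟨p, ⟨hpC, hpr⟩, hpmin⟩ := (hr.inter_left (isClosed_closure (s := C))).exists_infDist_eq_dist
    ⟨x, subset_closure hx, mem_closedBall_self (by linarith)⟩ y
  have hpy : ∀ q ∈ closure C, dist y p ≤ dist y q := by
    have hmin : ∀ q ∈ closure C ∩ closedBall x r, dist y p ≤ dist y q := fun q hq =>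
      hpmin ▸ infDist_le_dist_of_mem hq
    intro q hq
    by_cases hqr : q ∈ closedBall x r
    · exact hmin q ⟨hq, hqr⟩
    · rw [mem_closedBall, not_le] at hqr
      have h1 := hmin x ⟨subset_closure hx, mem_closedBall_self (by linarith)⟩
      have h2 := dist_triangle_left q x y
      linarith
  have hpyx : dist y p < ε := (hpy x (subset_closure hx)).trans_lt hyx
  have hpx : dist p x < 2 * ε := by
    have := dist_triangle_left p x y
    linarith
  have hne : p ≠ y := fun he => hyC (he ▸ hpC)
  have hs0 : 0 < dist p y := dist_pos.2 hne
  obtain ⟨γ, hγl, hγ0, hγy⟩ := hext p y (by rw [mem_ball]; linarith) (by rw [mem_ball]; linarith)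
    hne (by rw [dist_comm]; linarith)
  have hργ : ρ ≤ γ.l := by rw [hγl]; exact hρR
  refine ⟨γ.map ρ, ?_, fun c hc => ?_⟩
  · have hpz : dist (γ.map ρ) p = ρ := by
      rw [← hγ0, γ.isom ρ ⟨hρ0.le, hργ⟩ 0 ⟨le_rfl, γ.l_nonneg⟩, sub_zero, abs_of_pos hρ0]
    have h1 := dist_triangle (γ.map ρ) p x
    have h2 := dist_triangle_right (γ.map ρ) p x
    exact abs_le.2 ⟨by linarith, by linarith⟩
  · refine le_dist_of_extension hκ h hg hC (γ.restrict ρ hρ0.le hργ) hs0 ?_ hρk ?_ ?_ hc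
    · change dist p y ≤ ρ
      rw [dist_comm]; linarith
    · change γ.map 0 ∈ closure C
      rwa [hγ0]
    · intro q hq
      change dist p y ≤ dist (γ.map (dist p y)) q
      rw [hγy, dist_comm p y]
      exact hpy q (subset_closure hq)

/-- A point of `C` outside the interior of the closure of `C` is the nearest point to some other
point. -/
theorem Standing.exists_projSet_eq {κ : ℝ} {R : X → ℝ} (hX : Standing κ X R)
    {C : Set X} (hC : GConvex C) {x : X} (hx : x ∈ C) (hxC : x ∉ interior (closure C)) :
    ∃ z, z ≠ x ∧ projSet C z = {x} := by
  have hk : 0 < √κ := Real.sqrt_pos.2 hX.kpos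
  have hpi := Real.pi_pos
  have := hX.locComp
  obtain ⟨K, hK, hKx⟩ := exists_compact_mem_nhds x
  obtain ⟨r, hr0, hrK⟩ := nhds_basis_closedBall.mem_iff.1 hKx
  have hr : IsCompact (closedBall x r) := hK.of_isClosed_subset isClosed_closedBall hrK
  set ρ := min (R x) (min (r / 2) (π / (9 * √κ))) with hρ
  have hρ0 : 0 < ρ := lt_min (hX.Rpos x) (lt_min (by linarith) (by positivity))
  have hρR : ρ ≤ R x := min_le_left _ _
  have hρr : ρ ≤ r / 2 := (min_le_right _ _).trans (min_le_left _ _)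
  have hρk : √κ * ρ < π / 8 := by
    have h1 : ρ ≤ π / (9 * √κ) := (min_le_right _ _).trans (min_le_right _ _)
    rw [le_div_iff₀ (by positivity)] at h1
    linarith
  have hseq : ∀ n : ℕ, ∃ z, |dist z x - ρ| ≤ ρ / (n + 1) ∧ ∀ c ∈ C, ρ ≤ dist z c := by
    intro n
    obtain ⟨z, hz1, hz2⟩ := exists_far_point (ε := ρ / (n + 1) / 2) hX.kpos hX.cat hX.geod hC hx
      (hX.ext x) hρR hρk hr (by linarith) hxC (by positivity) (by
        rw [mul_div_cancel₀ _ two_ne_zero]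
        exact div_le_self hρ0.le (by linarith [n.cast_nonneg (α := ℝ)]))
    exact ⟨z, by rwa [mul_div_cancel₀ _ two_ne_zero] at hz1, hz2⟩
  choose z hz1 hz2 using hseq
  have hzr : ∀ n, z n ∈ closedBall x r := by
    intro n
    have h1 : ρ / ((n : ℝ) + 1) ≤ ρ := div_le_self hρ0.le (by linarith [n.cast_nonneg (α := ℝ)])
    rw [mem_closedBall]
    linarith [(abs_le.1 (hz1 n)).2]
  obtain ⟨w, -, φ, hφ, hw⟩ := hr.tendsto_subseq hzr
  have hlim : Tendsto (fun n => dist (z n) x) atTop (nhds ρ) := by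
    rw [tendsto_iff_dist_tendsto_zero]
    refine squeeze_zero (fun _ => dist_nonneg) hz1 ?_
    simpa [div_eq_mul_inv] using (tendsto_one_div_add_atTop_nhds_zero_nat (𝕜 := ℝ)).const_mul ρ
  have hwx : dist w x = ρ :=
    tendsto_nhds_unique (hw.dist tendsto_const_nhds) (hlim.comp hφ.tendsto_atTop)
  refine ⟨w, dist_pos.1 (hwx ▸ hρ0), projSet_eq_singleton hX.kpos hX.cat hX.geod hC hx
    (by rwa [hwx]) fun c hc => ?_⟩
  rw [hwx]
  exact ge_of_tendsto' (hw.dist tendsto_const_nhds) fun n => hz2 (φ n) c hc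

/-- An interior point of `C` is not the nearest point of `C` to another point on a geodesic
issuing at it. -/
theorem projSet_ne_singleton_of_mem_interior {C : Set X} (γ : Geodesic X)
    (hx : γ.map 0 ∈ interior C) {t : ℝ} (ht : 0 < t) (htl : t ≤ γ.l) :
    projSet C (γ.map t) ≠ {γ.map 0} := by
  intro hproj
  obtain ⟨ε, hε, hball⟩ := Metric.isOpen_iff.1 isOpen_interior _ hx
  set δ := min (ε / 2) t with hδ
  have hδ0 : 0 < δ := lt_min (by linarith) ht
  have hδt : δ ≤ t := min_le_right _ _
  have hδI : δ ∈ Set.Icc 0 γ.l := ⟨hδ0.le, hδt.trans htl⟩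
  have h0I : (0 : ℝ) ∈ Set.Icc 0 γ.l := ⟨le_rfl, γ.l_nonneg⟩
  have htI : t ∈ Set.Icc 0 γ.l := ⟨ht.le, htl⟩
  have hmem : γ.map δ ∈ C := by
    refine interior_subset (hball ?_)
    rw [mem_ball, γ.isom δ hδI 0 h0I, sub_zero, abs_of_pos hδ0]
    linarith [min_le_left (ε / 2) t]
  have hx' : γ.map 0 ∈ projSet C (γ.map t) := by rw [hproj]; rfl
  have hle := hx'.2 _ hmem
  rw [γ.isom t htI 0 h0I, γ.isom t htI δ hδI, sub_zero, abs_of_pos ht,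
    abs_of_nonneg (by linarith)] at hle
  linarith

end

/-- Proposition 3.4: (i) if `x ∈ int C` then `N_C(x) = {o_x}`; (ii) if `N_C(x) = {o_x}`
then `x ∈ int (closure C)`.  (The condition `N_C(x) = {o_x}` is expressed by saying that
every tangent element of `N_C(x)` has `r = 0`; the origin always belongs to `N_C(x)`.) -/
theorem statement3 {X : Type*} [MetricSpace X] {κ : ℝ} {R : X → ℝ} (hX : Standing κ X R)
    (C : Set X) (hCne : C.Nonempty) (hCconv : GConvex C) (x : X) (hx : x ∈ C) :
    (x ∈ interior C →
      ∀ (γ : Geodesic X) (r : ℝ), InTangent x γ r → InNormalCone C x γ r → r = 0) ∧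
    ((∀ (γ : Geodesic X) (r : ℝ), InTangent x γ r → InNormalCone C x γ r → r = 0) →
      x ∈ interior (closure C)) := by
  refine ⟨fun hint γ r hγ hN => ?_, fun hN => ?_⟩
  · rcases hN with hr | ⟨t, ht, htl, hproj⟩
    · exact hr
    · obtain ⟨rfl, -⟩ := hγ
      exact absurd hproj (projSet_ne_singleton_of_mem_interior γ hint ht htl)
  · by_contra hxC
    obtain ⟨z, hzx, hproj⟩ := hX.exists_projSet_eq hCconv hx hxC
    obtain ⟨γ, hγ0, hγl, hγ1⟩ := hX.geod x z
    have hl : 0 < γ.l := by rw [hγl]; exact dist_pos.2 (Ne.symm hzx)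
    exact one_ne_zero (hN γ 1 ⟨hγ0, zero_le_one, Or.inr hl⟩
      (Or.inr ⟨γ.l, hl, le_rfl, by rw [hγ1, hproj]⟩))

end CATPaper
end
end

section
/- Given x ∈ X, in the geodesic space X × ℝ, for a nonconstant geodesic σ issuing at (x,0) one has ([σ],1) ∈ N_{X × ℝ₊}(x,0) if and only if σ : [0,l] → X × ℝ is defined by σ(t) = (x,−t) for all t ∈ [0,l], where ℝ₊ denotes the set of nonnegative reals. -/
/-!
Basic convex analysis in metric spaces with bounded curvature:
common definitions (geodesics, Alexandrov angles, tangent-space elements,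
normal cones, subdifferentials, CAT(κ) conditions).
-/

open Metric Real Set Filter

noncomputable section

namespace CATPaper

theorem toXR_eq_iff {X : Type*} [MetricSpace X] {x y : X} {a b : ℝ} :
    toXR x a = toXR y b ↔ x = y ∧ a = b := by
  simp [toXR]

theorem exists_eq_toXR {X : Type*} [MetricSpace X] (p : XR X) : ∃ y a, p = toXR y a :=
  ⟨p.fst, p.snd, rfl⟩

theorem dist_toXR_sq {X : Type*} [MetricSpace X] (x y : X) (a b : ℝ) :
    dist (toXR x a) (toXR y b) ^ 2 = dist x y ^ 2 + (a - b) ^ 2 := by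
  rw [WithLp.prod_dist_eq_add (by norm_num), ← Real.rpow_mul_natCast (by positivity)]
  simp [toXR, Real.dist_eq, sq_abs]

/-- The metric projection of a point strictly below `X × ℝ₊` drops the real coordinate to `0`. -/
theorem projSet_toXR_of_neg {X : Type*} [MetricSpace X] (y : X) {b : ℝ} (hb : b < 0) :
    projSet {p : XR X | 0 ≤ ((WithLp.equiv 2 (X × ℝ)) p).2} (toXR y b) = {toXR y 0} := by
  have le_of_mem : ∀ c : XR X, 0 ≤ ((WithLp.equiv 2 (X × ℝ)) c).2 →
      dist (toXR y b) (toXR y 0) ≤ dist (toXR y b) c := by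
    intro c hc
    obtain ⟨z, a, rfl⟩ := exists_eq_toXR c
    have ha : 0 ≤ a := hc
    refine le_of_sq_le_sq ?_ dist_nonneg
    rw [dist_toXR_sq, dist_toXR_sq, dist_self]
    nlinarith [sq_nonneg (dist y z), mul_nonneg ha (neg_nonneg.2 hb.le)]
  have mem_zero : 0 ≤ ((WithLp.equiv 2 (X × ℝ)) (toXR y 0)).2 := le_refl (0 : ℝ)
  ext p
  constructor
  · rintro ⟨hp, hmin⟩
    obtain ⟨z, a, rfl⟩ := exists_eq_toXR p
    have ha : 0 ≤ a := hp
    have h := pow_le_pow_left₀ dist_nonneg (hmin _ mem_zero) 2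
    rw [dist_toXR_sq, dist_toXR_sq, dist_self] at h
    have hab := mul_nonneg ha (neg_nonneg.2 hb.le)
    have hd : dist y z ^ 2 = 0 := by nlinarith [sq_nonneg (dist y z)]
    have ha2 : a ^ 2 = 0 := by nlinarith [sq_nonneg a]
    exact toXR_eq_iff.2 ⟨(dist_eq_zero.1 (pow_eq_zero_iff two_ne_zero |>.1 hd)).symm,
      pow_eq_zero_iff two_ne_zero |>.1 ha2⟩
  · rintro rfl
    exact ⟨mem_zero, le_of_mem⟩

/-- A geodesic of `X × ℝ` issuing at `(x, 0)` and passing through `(x, b)` with `b < 0`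
is vertical. -/
theorem Geodesic.eq_toXR_neg {X : Type*} [MetricSpace X] {x : X} {σ : Geodesic (XR X)}
    (hσ0 : σ.map 0 = toXR x 0) {t b : ℝ} (ht0 : 0 < t) (htl : t ≤ σ.l) (hb : b < 0)
    (hσt : σ.map t = toXR x b) :
    ∀ s ∈ Set.Icc (0:ℝ) σ.l, σ.map s = toXR x (-s) := by
  intro s hs
  have h0 : (0 : ℝ) ∈ Set.Icc (0:ℝ) σ.l := ⟨le_rfl, σ.l_nonneg⟩
  have ht : t ∈ Set.Icc (0:ℝ) σ.l := ⟨ht0.le, htl⟩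
  obtain ⟨z, c, hz⟩ := exists_eq_toXR (σ.map s)
  have dist_t := congrArg (· ^ 2) (σ.isom t ht 0 h0)
  have dist_s0 := congrArg (· ^ 2) (σ.isom s hs 0 h0)
  have dist_st := congrArg (· ^ 2) (σ.isom s hs t ht)
  simp only [hσ0, hσt, hz, dist_toXR_sq, sq_abs, dist_self] at dist_t dist_s0 dist_st
  have hbt : b = -t := by
    have : (b - t) * (b + t) = 0 := by linarith
    rcases mul_eq_zero.1 this with h | h <;> linarith
  subst hbt
  have hc : c = -s := by
    have : t * (c + s) = 0 := by linarith
    rcases mul_eq_zero.1 this with h | h <;> linarith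
  subst hc
  have hd : dist z x ^ 2 = 0 := by linarith
  rw [hz, dist_eq_zero.1 (pow_eq_zero_iff two_ne_zero |>.1 hd)]

/-- Example 3.5(iv): in `X × ℝ`, for a nonconstant geodesic `σ` issuing at `(x,0)` one has
`([σ],1) ∈ N_{X × ℝ₊}(x,0)` iff `σ(t) = (x, -t)` for all `t ∈ [0, l]`. -/
theorem statement5 {X : Type*} [MetricSpace X] {κ : ℝ} {R : X → ℝ} (hX : Standing κ X R)
    (x : X) (σ : Geodesic (XR X)) (hσ0 : σ.map 0 = toXR x 0) (hσl : 0 < σ.l) :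
    InNormalCone {p : XR X | 0 ≤ ((WithLp.equiv 2 (X × ℝ)) p).2} (toXR x 0) σ 1 ↔
      ∀ t ∈ Set.Icc (0:ℝ) σ.l, σ.map t = toXR x (-t) := by
  constructor
  · rintro (h | ⟨t, ht0, htl, hproj⟩)
    · exact absurd h one_ne_zero
    obtain ⟨y, b, hy⟩ := exists_eq_toXR (σ.map t)
    rw [hy] at hproj
    rcases le_or_gt 0 b with hb | hb
    · have hmem : toXR y b ∈
          projSet {p : XR X | 0 ≤ ((WithLp.equiv 2 (X × ℝ)) p).2} (toXR y b) :=
        ⟨hb, fun c _ => by rw [dist_self]; exact dist_nonneg⟩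
      rw [hproj, Set.mem_singleton_iff] at hmem
      have h := σ.isom t ⟨ht0.le, htl⟩ 0 ⟨le_rfl, σ.l_nonneg⟩
      rw [hy, hmem, hσ0, dist_self, sub_zero, abs_of_pos ht0] at h
      exact absurd h ht0.ne
    · rw [projSet_toXR_of_neg y hb, Set.singleton_eq_singleton_iff, toXR_eq_iff] at hproj
      rw [hproj.1] at hy
      exact Geodesic.eq_toXR_neg hσ0 ht0 htl hb hy
  · intro h
    refine Or.inr ⟨σ.l, hσl, le_rfl, ?_⟩
    rw [h σ.l ⟨hσl.le, le_rfl⟩]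
    exact projSet_toXR_of_neg x (neg_lt_zero.2 hσl)

end CATPaper
end
end

section
/- Let (X,d) be a uniquely geodesic metric space, let f : X → (−∞,∞] be convex, and let x ∈ dom f. Suppose X has the geodesic extension property around x. Then the following are equivalent: (i) f is continuous at x; (ii) f is bounded on a neighborhood of x; (iii) f is Lipschitz on a neighborhood of x. -/
/-!
Basic convex analysis in metric spaces with bounded curvature:
common definitions (geodesics, Alexandrov angles, tangent-space elements,
normal cones, subdifferentials, CAT(κ) conditions).
-/

open Metric Real Set Filter

noncomputable section

namespace CATPaper

/-- A convex function with values in `[-M, M]` on `ball x r` is Lipschitz from above with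
constant `4 * M / r` on `ball x (r / 4)`, provided geodesics extend around `x`. -/
theorem GConvexFn.toReal_sub_le_of_bounded {X : Type*} [MetricSpace X] {f : X → EReal}
    (hconv : GConvexFn f) {x : X} {R r M : ℝ} (hext : GeodExtAround x R) (hr : 0 < r)
    (hrR : r ≤ R)
    (hM : ∀ y ∈ ball x r, f y ∈ Set.Icc ((-M : ℝ) : EReal) ((M : ℝ) : EReal))
    {y z : X} (hy : y ∈ ball x (r / 4)) (hz : z ∈ ball x (r / 4)) :
    (f z).toReal - (f y).toReal ≤ 4 * M / r * dist y z := by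
  rcases eq_or_ne y z with rfl | hyz
  · simp
  have hreal : ∀ w ∈ ball x r, ∃ a : ℝ, f w = a ∧ -M ≤ a ∧ a ≤ M := by
    intro w hw
    obtain ⟨h₁, h₂⟩ := hM w hw
    have hcoe : ((f w).toReal : EReal) = f w :=
      EReal.coe_toReal (ne_top_of_le_ne_top (EReal.coe_ne_top M) h₂)
        (ne_bot_of_le_ne_bot (EReal.coe_ne_bot (-M)) h₁)
    rw [← hcoe, EReal.coe_le_coe_iff] at h₁ h₂
    exact ⟨_, hcoe.symm, h₁, h₂⟩
  rw [mem_ball] at hy hz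
  have hd : dist y z < r / 2 := by
    linarith [dist_triangle_right y z x]
  have hd0 : 0 ≤ dist y z := dist_nonneg
  obtain ⟨γ, hl, h0, hγz⟩ := hext y z (mem_ball.2 (by linarith)) (mem_ball.2 (by linarith)) hyz
    (by linarith)
  let η : Geodesic X := ⟨r / 2, by linarith, γ.map, fun s hs t ht =>
    γ.isom s ⟨hs.1, by linarith [hs.2]⟩ t ⟨ht.1, by linarith [ht.2]⟩⟩
  have hw : γ.map (r / 2) ∈ ball x r := by
    have h := γ.isom 0 ⟨le_rfl, γ.l_nonneg⟩ (r / 2) ⟨by linarith, by linarith⟩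
    rw [h0, zero_sub, abs_neg, abs_of_pos (by linarith)] at h
    rw [mem_ball]
    linarith [dist_triangle_left (γ.map (r / 2)) x y]
  set t : ℝ := dist y z / (r / 2) with ht
  have ht0 : 0 ≤ t := by positivity
  have ht1 : t ≤ 1 := (div_le_one (by linarith)).2 hd.le
  have htr : t * (r / 2) = dist y z := div_mul_cancel₀ _ (by linarith)
  have hc := hconv η t ⟨ht0, ht1⟩
  obtain ⟨a, ha, ha₁, -⟩ := hreal y (mem_ball.2 (by linarith))
  obtain ⟨b, hb, -, -⟩ := hreal z (mem_ball.2 (by linarith))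
  obtain ⟨c, hfw, -, hc₂⟩ := hreal _ hw
  simp only [η, htr, h0, hγz, ha, hb, hfw] at hc
  rw [← EReal.coe_mul, ← EReal.coe_mul, ← EReal.coe_add, EReal.coe_le_coe_iff] at hc
  rw [ha, hb, EReal.toReal_coe, EReal.toReal_coe]
  have hbound : t * (c - a) ≤ t * (2 * M) := mul_le_mul_of_nonneg_left (by linarith) ht0
  have hLip : t * (2 * M) = 4 * M / r * dist y z := by
    rw [ht]
    field_simp
    ring
  linarith

/-- Lemma 4.3: for a convex function `f : X → (-∞,∞]` on a uniquely geodesic space with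
the geodesic extension property around `x ∈ dom f`, the following are equivalent:
(i) `f` is continuous at `x`; (ii) `f` is bounded on a neighborhood of `x`;
(iii) `f` is Lipschitz on a neighborhood of `x`. -/
theorem statement6 {X : Type*} [MetricSpace X]
    (hgeo : GeodesicSpace X) (huniq : UniquelyGeodesic X)
    (f : X → EReal) (hfbot : ∀ y, f y ≠ ⊥) (hconv : GConvexFn f)
    (x : X) (hx : f x < ⊤) (Rx : ℝ) (hRx : 0 < Rx) (hext : GeodExtAround x Rx) :
    List.TFAE
      [ContinuousAt f x,
       ∃ M : ℝ, ∀ᶠ y in nhds x, f y ∈ Set.Icc ((-M : ℝ) : EReal) ((M : ℝ) : EReal),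
       ∃ U ∈ nhds x, (∀ y ∈ U, f y ≠ ⊤) ∧ ∃ L : ℝ,
         ∀ y ∈ U, ∀ z ∈ U, |(f y).toReal - (f z).toReal| ≤ L * dist y z] := by
  tfae_have 1 → 2 := by
    intro hcont
    have hcoe : ((f x).toReal : EReal) = f x := EReal.coe_toReal hx.ne (hfbot x)
    set a := (f x).toReal
    have hlt : ((-(|a| + 1) : ℝ) : EReal) < f x := by
      rw [← hcoe, EReal.coe_lt_coe_iff]
      linarith [neg_abs_le a]
    have hgt : f x < ((|a| + 1 : ℝ) : EReal) := by
      rw [← hcoe, EReal.coe_lt_coe_iff]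
      linarith [le_abs_self a]
    exact ⟨|a| + 1, hcont (Icc_mem_nhds hlt hgt)⟩
  tfae_have 2 → 3 := by
    rintro ⟨M, hM⟩
    obtain ⟨ε, hε, hball⟩ := Metric.eventually_nhds_iff_ball.1 hM
    have hr : 0 < min ε Rx := lt_min hε hRx
    have hbdd : ∀ y ∈ ball x (min ε Rx), f y ∈ Set.Icc ((-M : ℝ) : EReal) ((M : ℝ) : EReal) :=
      fun y hy => hball y (ball_subset_ball (min_le_left _ _) hy)
    refine ⟨ball x (min ε Rx / 4), ball_mem_nhds x (by linarith), fun y hy => ?_,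
      4 * M / min ε Rx, fun y hy z hz => ?_⟩
    · exact ne_top_of_le_ne_top (EReal.coe_ne_top M)
        (hbdd y (ball_subset_ball (by linarith) hy)).2
    · refine abs_sub_le_iff.2 ⟨?_, ?_⟩
      · rw [dist_comm]
        exact hconv.toReal_sub_le_of_bounded hext hr (min_le_right _ _) hbdd hz hy
      · exact hconv.toReal_sub_le_of_bounded hext hr (min_le_right _ _) hbdd hy hz
  tfae_have 3 → 1 := by
    rintro ⟨U, hU, htop, L, hL⟩
    have hxU : x ∈ U := mem_of_mem_nhds hU
    have hreal : ContinuousAt (fun y => (f y).toReal) x := by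
      have hlim : Tendsto (fun y => L * dist y x) (nhds x) (nhds 0) := by
        have h : Continuous fun y => L * dist y x := by fun_prop
        simpa using h.tendsto x
      refine tendsto_iff_dist_tendsto_zero.2
        (squeeze_zero' (Eventually.of_forall fun _ => dist_nonneg) ?_ hlim)
      filter_upwards [hU] with y hy
      rw [Real.dist_eq]
      exact hL y hy x hxU
    refine (continuous_coe_real_ereal.continuousAt.comp hreal).congr ?_
    filter_upwards [hU] with y hy
    exact EReal.coe_toReal (htop y hy) (hfbot y)
  tfae_finish

end CATPaper
end
end

section
/- Let (X,d) be a complete, locally compact CAT(0) space with the geodesic extension property, and let C ⊆ X be nonempty, convex, and closed. For x ∉ C, let Γ_x be the set of all geodesics γ : [0,1] → X issuing at x with d(P_C(x),x) + 1 = d(P_C(x),γ(1)), where P_C(x) is the metric projection of x onto C. Define f : X → ℝ by f(x) = dist(x,C). Then ∂f(x) = {([γ],1) ∈ T_x X : γ ∈ Γ_x} if x ∉ C; ∂f(x) = {([γ],r) ∈ N_C(x) : r ∈ [0,1]} if x is a boundary point of C; and ∂f(x) = {o_x} if x is an interior point of C. -/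
/-!
Basic convex analysis in metric spaces with bounded curvature:
common definitions (geodesics, Alexandrov angles, tangent-space elements,
normal cones, subdifferentials, CAT(κ) conditions).
-/

open Metric Real Set Filter

noncomputable section

namespace CATPaper

/-- In a `CAT(0)` space, the comparison inequality holds at every point lying between `p` and `q`,
and not only along a chosen geodesic. -/
theorem IsCAT0.dist_sq_le_of_between {X : Type*} [MetricSpace X] (hcat : IsCAT0 X)
    {p q m : X} {θ : ℝ} (hθ : θ ∈ Set.Icc (0 : ℝ) 1) (hpm : dist p m = θ * dist p q)
    (hmq : dist m q = (1 - θ) * dist p q) (z : X) :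
    dist z m ^ 2 ≤
      (1 - θ) * dist z p ^ 2 + θ * dist z q ^ 2 - θ * (1 - θ) * dist p q ^ 2 := by
  obtain ⟨η, h0, hl, h1⟩ := hcat.1 p q
  have hm := hcat.2 m η θ hθ
  rw [h0, h1, hl, dist_comm m p, hpm, hmq] at hm
  have hm_eq : m = η.map (θ * dist p q) := by
    refine dist_le_zero.1 ?_
    nlinarith [dist_nonneg (x := m) (y := η.map (θ * dist p q))]
  have hz := hcat.2 z η θ hθ
  rwa [h0, h1, hl, ← hm_eq] at hz

/-- A convex set in a `CAT(0)` space contains a point dividing any two of its points in a given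
ratio. -/
theorem GConvex.exists_between {X : Type*} [MetricSpace X] (hcat : IsCAT0 X) {C : Set X}
    (hC : GConvex C) {p q : X} (hp : p ∈ C) (hq : q ∈ C) {θ : ℝ} (hθ : θ ∈ Set.Icc (0 : ℝ) 1) :
    ∃ m ∈ C, dist p m = θ * dist p q ∧ dist m q = (1 - θ) * dist p q := by
  obtain ⟨η, rfl, hl, rfl⟩ := hcat.1 p q
  rw [← hl]
  have hmem : θ * η.l ∈ Set.Icc (0 : ℝ) η.l :=
    ⟨mul_nonneg hθ.1 η.l_nonneg, mul_le_of_le_one_left η.l_nonneg hθ.2⟩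
  refine ⟨η.map (θ * η.l), hC η hp hq _ hmem, ?_, ?_⟩
  · rw [η.isom 0 ⟨le_rfl, η.l_nonneg⟩ _ hmem, zero_sub, abs_neg, abs_of_nonneg hmem.1]
  · rw [η.isom _ hmem _ ⟨η.l_nonneg, le_rfl⟩, abs_of_nonpos (by linarith [hmem.2])]
    ring

theorem IsCAT0.exists_between {X : Type*} [MetricSpace X] (hcat : IsCAT0 X) (p q : X)
    {θ : ℝ} (hθ : θ ∈ Set.Icc (0 : ℝ) 1) :
    ∃ m, dist p m = θ * dist p q ∧ dist m q = (1 - θ) * dist p q := by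
  have huniv : GConvex (Set.univ : Set X) := fun _ _ _ _ _ => Set.mem_univ _
  obtain ⟨m, -, hm⟩ := huniv.exists_between hcat (Set.mem_univ p) (Set.mem_univ q) hθ
  exact ⟨m, hm⟩

/-- Points dividing two sides of a triangle in the same ratio are no farther apart than in the
Euclidean plane. -/
theorem IsCAT0.dist_between_le_of_common_end {X : Type*} [MetricSpace X] (hcat : IsCAT0 X)
    {x y z m k : X} {θ : ℝ} (hθ : θ ∈ Set.Icc (0 : ℝ) 1)
    (hxm : dist x m = θ * dist x y) (hmy : dist m y = (1 - θ) * dist x y)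
    (hxk : dist x k = θ * dist x z) (hkz : dist k z = (1 - θ) * dist x z) :
    dist m k ≤ θ * dist y z := by
  have h1 := hcat.dist_sq_le_of_between hθ hxk hkz m
  have h2 := hcat.dist_sq_le_of_between hθ hxm hmy z
  rw [dist_comm m x, hxm] at h1
  rw [dist_comm z m, dist_comm z x, dist_comm z y] at h2
  refine abs_le_of_sq_le_sq' ?_ (mul_nonneg hθ.1 dist_nonneg) |>.2
  nlinarith [mul_le_mul_of_nonneg_left h2 hθ.1]

/-- The distance between points of two segments of a `CAT(0)` space is convex. -/
theorem IsCAT0.dist_between_le {X : Type*} [MetricSpace X] (hcat : IsCAT0 X)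
    {x y p q m n : X} {θ : ℝ} (hθ : θ ∈ Set.Icc (0 : ℝ) 1)
    (hxm : dist x m = θ * dist x y) (hmy : dist m y = (1 - θ) * dist x y)
    (hpn : dist p n = θ * dist p q) (hnq : dist n q = (1 - θ) * dist p q) :
    dist m n ≤ (1 - θ) * dist x p + θ * dist y q := by
  obtain ⟨k, hxk, hkq⟩ := hcat.exists_between x q hθ
  have hmk := hcat.dist_between_le_of_common_end hθ hxm hmy hxk hkq
  have hkn := hcat.dist_between_le_of_common_end (x := q) (y := x) (z := p) (m := k) (k := n)
    (θ := 1 - θ) ⟨by linarith [hθ.2], by linarith [hθ.1]⟩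
    (by rw [dist_comm, hkq, dist_comm q]) (by rw [dist_comm, hxk, dist_comm q]; ring)
    (by rw [dist_comm, hnq, dist_comm q]) (by rw [dist_comm, hpn, dist_comm q]; ring)
  linarith [dist_triangle m k n]

theorem infDist_eq_of_mem_projSet {X : Type*} [MetricSpace X] {C : Set X} {z p : X}
    (hp : p ∈ projSet C z) : infDist z C = dist z p :=
  le_antisymm (infDist_le_dist_of_mem hp.1)
    ((le_infDist ⟨p, hp.1⟩).2 hp.2)

/-- Almost nearest points of a convex set are close to each other. -/
theorem GConvex.dist_sq_le_of_dist_le {X : Type*} [MetricSpace X] (hcat : IsCAT0 X) {C : Set X}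
    (hC : GConvex C) {z p q : X} (hp : p ∈ C) (hq : q ∈ C) {ρ : ℝ}
    (hzp : dist z p ≤ ρ) (hzq : dist z q ≤ ρ) :
    dist p q ^ 2 ≤ 4 * (ρ ^ 2 - infDist z C ^ 2) := by
  have hθ : (1 / 2 : ℝ) ∈ Set.Icc (0 : ℝ) 1 := by norm_num
  obtain ⟨m, hm, hpm, hmq⟩ := hC.exists_between hcat hp hq hθ
  have h := hcat.dist_sq_le_of_between hθ hpm hmq z
  have hle : infDist z C ^ 2 ≤ dist z m ^ 2 :=
    pow_le_pow_left₀ infDist_nonneg (infDist_le_dist_of_mem hm) 2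
  have h1 := pow_le_pow_left₀ dist_nonneg hzp 2
  have h2 := pow_le_pow_left₀ dist_nonneg hzq 2
  linarith

theorem GConvex.projSet_eq_singleton {X : Type*} [MetricSpace X] (hcat : IsCAT0 X) {C : Set X}
    (hC : GConvex C) {z p : X} (hp : p ∈ projSet C z) : projSet C z = {p} := by
  refine Set.eq_singleton_iff_unique_mem.2 ⟨hp, fun q hq => ?_⟩
  have h := hC.dist_sq_le_of_dist_le hcat hq.1 hp.1 (hq.2 p hp.1) le_rfl
  rw [infDist_eq_of_mem_projSet hp, sub_self, mul_zero] at h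
  exact dist_eq_zero.1 (pow_eq_zero_iff two_ne_zero |>.1 (le_antisymm h (sq_nonneg _)))

/-- The metric projection onto a nonempty closed convex set of a complete `CAT(0)` space exists. -/
theorem GConvex.exists_mem_projSet {X : Type*} [MetricSpace X] [CompleteSpace X]
    (hcat : IsCAT0 X) {C : Set X} (hCne : C.Nonempty) (hC : GConvex C) (hCcl : IsClosed C)
    (z : X) : ∃ p, p ∈ projSet C z := by
  set δ := infDist z C with hδ
  have hseq : ∀ n : ℕ, ∃ c ∈ C, dist z c < δ + 1 / ((n : ℝ) + 1) := fun n =>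
    (infDist_lt_iff hCne).1 (by rw [← hδ]; linarith [Nat.one_div_pos_of_nat (α := ℝ) (n := n)])
  choose c hcC hc using hseq
  have hlim : Tendsto (fun n : ℕ => δ + 1 / ((n : ℝ) + 1)) atTop (nhds δ) := by
    simpa using tendsto_const_nhds.add (tendsto_one_div_add_atTop_nhds_zero_nat (𝕜 := ℝ))
  have hcauchy : CauchySeq c := by
    refine cauchySeq_of_le_tendsto_0
      (fun N : ℕ => √(4 * ((δ + 1 / ((N : ℝ) + 1)) ^ 2 - δ ^ 2))) (fun n m N hn hm => ?_) ?_
    · refine Real.le_sqrt_of_sq_le (hC.dist_sq_le_of_dist_le hcat (hcC n) (hcC m) ?_ ?_)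
      · exact (hc n).le.trans (by linarith [Nat.one_div_le_one_div (α := ℝ) hn])
      · exact (hc m).le.trans (by linarith [Nat.one_div_le_one_div (α := ℝ) hm])
    · have h := (((hlim.pow 2).sub_const (δ ^ 2)).const_mul 4).sqrt
      rwa [sub_self, mul_zero, Real.sqrt_zero] at h
  obtain ⟨p, hp⟩ := cauchySeq_tendsto_of_complete hcauchy
  have hpz : dist z p ≤ δ :=
    le_of_tendsto_of_tendsto' (tendsto_const_nhds.dist hp) hlim fun n => (hc n).le
  exact ⟨p, hCcl.mem_of_tendsto hp (Eventually.of_forall hcC),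
    fun y hy => hpz.trans (infDist_le_dist_of_mem hy)⟩

/-- The distance to a convex set is a convex function. -/
theorem GConvex.infDist_between_le {X : Type*} [MetricSpace X] [CompleteSpace X]
    (hcat : IsCAT0 X) {C : Set X} (hCne : C.Nonempty) (hC : GConvex C) (hCcl : IsClosed C)
    {x y m : X} {θ : ℝ} (hθ : θ ∈ Set.Icc (0 : ℝ) 1)
    (hxm : dist x m = θ * dist x y) (hmy : dist m y = (1 - θ) * dist x y) :
    infDist m C ≤ (1 - θ) * infDist x C + θ * infDist y C := by
  obtain ⟨p, hp⟩ := hC.exists_mem_projSet hcat hCne hCcl x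
  obtain ⟨q, hq⟩ := hC.exists_mem_projSet hcat hCne hCcl y
  obtain ⟨n, hn, hpn, hnq⟩ := hC.exists_between hcat hp.1 hq.1 hθ
  rw [infDist_eq_of_mem_projSet hp, infDist_eq_of_mem_projSet hq]
  exact (infDist_le_dist_of_mem hn).trans (hcat.dist_between_le hθ hxm hmy hpn hnq)

theorem dist_toXR {X : Type*} [MetricSpace X] (x y : X) (a b : ℝ) :
    dist (toXR x a) (toXR y b) = √(dist x y ^ 2 + (a - b) ^ 2) := by
  rw [WithLp.prod_dist_eq_add (by norm_num)]
  simp [toXR, Real.dist_eq, Real.sqrt_eq_rpow]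

/-- The geodesic of `X × ℝ` defining the subdifferential has unit speed. -/
theorem dist_toXR_descending {X : Type*} [MetricSpace X] {x y : X} {r s t a : ℝ}
    (h : dist x y = |r * s / √(r ^ 2 + 1) - r * t / √(r ^ 2 + 1)|) :
    dist (toXR x (a - s / √(r ^ 2 + 1))) (toXR y (a - t / √(r ^ 2 + 1))) = |s - t| := by
  have hpos : 0 < r ^ 2 + 1 := by positivity
  have hne : √(r ^ 2 + 1) ≠ 0 := (Real.sqrt_pos.2 hpos).ne'
  rw [dist_toXR, h, sq_abs, ← Real.sqrt_sq_eq_abs]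
  congr 1
  field_simp
  rw [Real.sq_sqrt hpos.le]
  ring

/-- The subgradients of a distance function in terms of a variational inequality. -/
theorem isSubgrad0_infDist_iff {X : Type*} [MetricSpace X] [CompleteSpace X]
    (hcat : IsCAT0 X) {C : Set X} (hCne : C.Nonempty) (hC : GConvex C) (hCcl : IsClosed C)
    {x : X} {γ : Geodesic X} {r : ℝ} (hγ : γ.map 0 = x) (hr : 0 ≤ r) :
    IsSubgrad0 (fun y => ((infDist y C : ℝ) : EReal)) x γ r ↔
      ∃ τ : ℝ, 0 < τ ∧
        (∀ s ∈ Set.Icc (0 : ℝ) (r * τ), ∀ t ∈ Set.Icc (0 : ℝ) (r * τ),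
          dist (γ.map s) (γ.map t) = |s - t|) ∧
        ∀ (y : X) (b : ℝ), infDist y C ≤ b →
          (r ^ 2 + 1) * τ ^ 2 ≤ dist (γ.map (r * τ)) y ^ 2 + (b - infDist x C + τ) ^ 2 := by
  have hpos : 0 < r ^ 2 + 1 := by positivity
  set c := √(r ^ 2 + 1) with hc
  have hc0 : 0 < c := Real.sqrt_pos.2 hpos
  have hc2 : c ^ 2 = r ^ 2 + 1 := Real.sq_sqrt hpos.le
  constructor
  · rintro ⟨σ, -, hσ, h | ⟨t, ht0, htl, hproj⟩⟩
    · exact absurd h one_ne_zero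
    simp only [EReal.toReal_coe, ← hc] at hσ hproj
    have hmem : toXR x (infDist x C) ∈ projSet (epigraph _) (σ.map t) :=
      hproj ▸ Set.mem_singleton _
    have hiso : ∀ u ∈ Set.Icc (0 : ℝ) (r * (t / c)), ∀ v ∈ Set.Icc (0 : ℝ) (r * (t / c)),
        dist (γ.map u) (γ.map v) = |u - v| := by
      intro u hu v hv
      rcases hr.eq_or_lt with rfl | hr0
      · obtain rfl : u = 0 := le_antisymm (by simpa using hu.2) hu.1
        obtain rfl : v = 0 := le_antisymm (by simpa using hv.2) hv.1
        simp
      have hmem' : ∀ w ∈ Set.Icc (0 : ℝ) (r * (t / c)), c * w / r ∈ Set.Icc (0 : ℝ) σ.l := by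
        intro w hw
        refine ⟨div_nonneg (mul_nonneg hc0.le hw.1) hr, htl.trans' ?_⟩
        rw [div_le_iff₀ hr0]
        have := mul_le_mul_of_nonneg_left hw.2 hc0.le
        calc c * w ≤ c * (r * (t / c)) := this
          _ = t * r := by field_simp
      have h := σ.isom _ (hmem' u hu) _ (hmem' v hv)
      rw [hσ, hσ, dist_toXR] at h
      have hw : ∀ w : ℝ, r * (c * w / r) / c = w := fun w => by field_simp
      have hw' : ∀ w : ℝ, c * w / r / c = w / r := fun w => by field_simp
      rw [hw, hw, hw', hw', ← Real.sqrt_sq_eq_abs, Real.sqrt_inj (by positivity) (by positivity)] at h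
      have hsq : dist (γ.map u) (γ.map v) ^ 2 = (u - v) ^ 2 := by
        have h' : dist (γ.map u) (γ.map v) ^ 2 = (c ^ 2 - 1) * (u / r - v / r) ^ 2 := by
          linear_combination h
        rw [h', hc2]
        field_simp
        ring
      rw [← Real.sqrt_sq_eq_abs, ← hsq, Real.sqrt_sq dist_nonneg]
    refine ⟨t / c, by positivity, hiso, fun y b hb => ?_⟩
    have h := hmem.2 (toXR y b) (by simpa [epigraph, toXR] using hb)
    rw [hσ, dist_toXR, dist_toXR] at h
    have h' := (Real.sqrt_le_sqrt_iff (by positivity)).1 h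
    have hx : dist (γ.map (r * t / c)) x = r * (t / c) := by
      have h0 : 0 ≤ r * (t / c) := by positivity
      rw [mul_div_assoc, dist_comm, ← hγ, hiso 0 ⟨le_rfl, h0⟩ _ ⟨h0, le_rfl⟩, zero_sub, abs_neg,
        abs_of_nonneg h0]
    rw [hx, mul_div_assoc] at h'
    nlinarith
  · rintro ⟨τ, hτ, hiso, hvar⟩
    have hrc : ∀ s ∈ Set.Icc (0 : ℝ) (c * τ), r * s / c ∈ Set.Icc (0 : ℝ) (r * τ) := by
      intro s hs
      refine ⟨div_nonneg (mul_nonneg hr hs.1) hc0.le, ?_⟩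
      rw [div_le_iff₀ hc0]
      nlinarith [mul_le_mul_of_nonneg_left hs.2 hr]
    refine ⟨⟨c * τ, by positivity,
      fun t => toXR (γ.map (r * t / c)) (infDist x C - t / c),
      fun s hs t ht => dist_toXR_descending (hiso _ (hrc s hs) _ (hrc t ht))⟩,
      by positivity, fun t => rfl, Or.inr ⟨c * τ, by positivity, le_rfl, ?_⟩⟩
    have h1 : r * (c * τ) / c = r * τ := by field_simp
    have h2 : c * τ / c = τ := by field_simp
    have h0 : 0 ≤ r * τ := by positivity
    have hx : dist (γ.map (r * τ)) x = r * τ := by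
      rw [dist_comm, ← hγ, hiso 0 ⟨le_rfl, h0⟩ _ ⟨h0, le_rfl⟩, zero_sub, abs_neg,
        abs_of_nonneg h0]
    simp only [h1, h2, EReal.toReal_coe]
    have hself : toXR x (infDist x C) ∈ epigraph (fun y => ((infDist y C : ℝ) : EReal)) := by
      simp [epigraph, toXR]
    have hdself : dist (toXR (γ.map (r * τ)) (infDist x C - τ)) (toXR x (infDist x C))
        = √((r ^ 2 + 1) * τ ^ 2) := by
      rw [dist_toXR, hx]; congr 1; ring
    refine Set.eq_singleton_iff_unique_mem.2 ⟨⟨hself, ?_⟩, ?_⟩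
    · intro z hz
      obtain ⟨⟨y, b⟩, rfl⟩ := (WithLp.equiv 2 (X × ℝ)).symm.surjective z
      rw [hdself]
      change _ ≤ dist _ (toXR y b)
      rw [dist_toXR]
      refine Real.sqrt_le_sqrt ((hvar y b (by simpa [epigraph] using hz)).trans_eq ?_)
      ring
    · intro z hz
      obtain ⟨⟨y, b⟩, rfl⟩ := (WithLp.equiv 2 (X × ℝ)).symm.surjective z
      change toXR y b = _
      have hle := hz.2 _ hself
      have hyb : infDist y C ≤ b := by simpa [epigraph] using hz.1
      rw [hdself] at hle
      change dist _ (toXR y b) ≤ _ at hle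
      rw [dist_toXR] at hle
      have hle' := (Real.sqrt_le_sqrt_iff (by positivity)).1 hle
      have hθ : (1 / 2 : ℝ) ∈ Set.Icc (0 : ℝ) 1 := by norm_num
      obtain ⟨m, hxm, hmy⟩ := hcat.exists_between x y hθ
      have hconv := hC.infDist_between_le hcat hCne hCcl hθ hxm hmy
      have hcn := hcat.dist_sq_le_of_between hθ hxm hmy (γ.map (r * τ))
      have hm := hvar m ((infDist x C + b) / 2) (by linarith)
      rw [hx] at hcn
      have hsum : dist x y ^ 2 + (b - infDist x C) ^ 2 ≤ 0 := by nlinarith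
      have hxy2 : dist x y ^ 2 = 0 := by
        linarith [sq_nonneg (dist x y), sq_nonneg (b - infDist x C)]
      have hab2 : (b - infDist x C) ^ 2 = 0 := by
        linarith [sq_nonneg (dist x y), sq_nonneg (b - infDist x C)]
      have hxy : x = y := dist_eq_zero.1 (pow_eq_zero_iff two_ne_zero |>.1 hxy2)
      have hab : b - infDist x C = 0 := pow_eq_zero_iff two_ne_zero |>.1 hab2
      subst hxy
      rw [sub_eq_zero.1 hab]

section Variational

variable {X : Type*} [MetricSpace X] {C : Set X} {x : X} {γ : Geodesic X} {r τ : ℝ}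

/-- A subgradient of a distance function has norm at most one. -/
theorem le_one_of_variational (hγ : γ.map 0 = x) (hr : 0 ≤ r) (hτ : 0 < τ)
    (hiso : ∀ s ∈ Set.Icc (0 : ℝ) (r * τ), ∀ t ∈ Set.Icc (0 : ℝ) (r * τ),
      dist (γ.map s) (γ.map t) = |s - t|)
    (hvar : ∀ (y : X) (b : ℝ), infDist y C ≤ b →
      (r ^ 2 + 1) * τ ^ 2 ≤ dist (γ.map (r * τ)) y ^ 2 + (b - infDist x C + τ) ^ 2) :
    r ≤ 1 := by
  by_contra! hr1
  have h0 : 0 ≤ r * τ := mul_nonneg hr hτ.le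
  set u := τ * (r - 1) / 2 with hu
  have hu0 : 0 < u := by have := sub_pos.2 hr1; positivity
  have hur : u ≤ r * τ := by rw [hu]; nlinarith
  have hxu : dist (γ.map u) x = u := by
    rw [dist_comm, ← hγ, hiso 0 ⟨le_rfl, h0⟩ u ⟨hu0.le, hur⟩, zero_sub, abs_neg,
      abs_of_nonneg hu0.le]
  have h := hvar (γ.map u) (infDist x C + u) (by
    simpa only [hxu] using infDist_le_infDist_add_dist (s := C) (x := γ.map u) (y := x))
  rw [hiso _ ⟨h0, le_rfl⟩ u ⟨hu0.le, hur⟩, sq_abs] at h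
  have hpos : 0 ≤ u * (u - τ * (r - 1)) := by nlinarith
  have hneg : u - τ * (r - 1) < 0 := by rw [hu]; rw [hu] at hu0; linarith
  linarith [mul_neg_of_pos_of_neg hu0 hneg]

/-- A point of `C` at which the variational inequality holds is a nearest point of `C` to the
first points of the geodesic. -/
theorem mem_projSet_of_variational (hγ : γ.map 0 = x) (hxC : x ∈ C)
    (hiso : ∀ s ∈ Set.Icc (0 : ℝ) (r * τ), ∀ t ∈ Set.Icc (0 : ℝ) (r * τ),
      dist (γ.map s) (γ.map t) = |s - t|)
    (hvar : ∀ (y : X) (b : ℝ), infDist y C ≤ b →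
      (r ^ 2 + 1) * τ ^ 2 ≤ dist (γ.map (r * τ)) y ^ 2 + (b - infDist x C + τ) ^ 2)
    {t : ℝ} (ht : t ∈ Set.Icc (0 : ℝ) (r * τ)) : x ∈ projSet C (γ.map t) := by
  have h0 : 0 ≤ r * τ := ht.1.trans ht.2
  refine ⟨hxC, fun y hy => ?_⟩
  have h := hvar y 0 (infDist_zero_of_mem hy).le
  rw [infDist_zero_of_mem hxC] at h
  have hqy : r * τ ≤ dist (γ.map (r * τ)) y :=
    abs_le_of_sq_le_sq' (by nlinarith) dist_nonneg |>.2
  have htx : dist (γ.map t) x = t := by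
    rw [dist_comm, ← hγ, hiso 0 ⟨le_rfl, h0⟩ t ht, zero_sub, abs_neg, abs_of_nonneg ht.1]
  have hqt := hiso _ ⟨h0, le_rfl⟩ t ht
  rw [abs_of_nonneg (by linarith [ht.2])] at hqt
  linarith [dist_triangle (γ.map (r * τ)) (γ.map t) y]

/-- The variational inequality forces the endpoint away from the nearest point `p` of `C`. -/
theorem dist_sq_ge_of_variational (hcat : IsCAT0 X)
    (hxq : dist (γ.map (r * τ)) x = r * τ)
    (hvar : ∀ (y : X) (b : ℝ), infDist y C ≤ b →
      (r ^ 2 + 1) * τ ^ 2 ≤ dist (γ.map (r * τ)) y ^ 2 + (b - infDist x C + τ) ^ 2)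
    {p : X} (hp : p ∈ projSet C x) :
    (r * τ) ^ 2 + dist x p ^ 2 + 2 * τ * dist x p ≤ dist (γ.map (r * τ)) p ^ 2 := by
  set a := dist x p with ha
  have ha0 : 0 ≤ a := dist_nonneg
  refine le_of_forall_pos_le_add fun ε hε => ?_
  set θ := min 1 (ε / (2 * a ^ 2 + 1)) with hθdef
  have hθ0 : 0 < θ := lt_min one_pos (by positivity)
  have hθ : θ ∈ Set.Icc (0 : ℝ) 1 := ⟨hθ0.le, min_le_left _ _⟩
  have hθε : θ * (2 * a ^ 2 + 1) ≤ ε := (le_div_iff₀ (by positivity)).1 (min_le_right _ _)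
  obtain ⟨y, hxy, hyp⟩ := hcat.exists_between x p hθ
  have hcn := hcat.dist_sq_le_of_between hθ hxy hyp (γ.map (r * τ))
  have h := hvar y ((1 - θ) * a) (hyp ▸ infDist_le_dist_of_mem hp.1)
  rw [infDist_eq_of_mem_projSet hp, ← ha] at h
  rw [hxq, ← ha] at hcn
  have hθmul : 0 ≤ θ * (dist (γ.map (r * τ)) p ^ 2 + 2 * θ * a ^ 2 -
      ((r * τ) ^ 2 + a ^ 2 + 2 * τ * a)) := by nlinarith
  have := nonneg_of_mul_nonneg_right hθmul hθ0
  linarith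

end Variational

/-- If a geodesic issuing at `x` extends a geodesic from `p` to `x` for a while, it does so for
all times. -/
theorem IsCAT0.dist_add_le_of_dist_add_le {X : Type*} [MetricSpace X] (hcat : IsCAT0 X)
    (γ : Geodesic X) {p : X} {τ : ℝ} (hτ : 0 < τ) (hτl : τ ≤ γ.l)
    (h : dist p (γ.map 0) + τ ≤ dist p (γ.map τ)) :
    dist p (γ.map 0) + γ.l ≤ dist p (γ.map γ.l) := by
  have hl : 0 < γ.l := hτ.trans_le hτl
  have hcn := hcat.2 p γ (τ / γ.l) ⟨by positivity, (div_le_one hl).2 hτl⟩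
  rw [div_mul_cancel₀ _ hl.ne'] at hcn
  have hsq := pow_le_pow_left₀ (by positivity) h 2
  obtain ⟨θ, rfl⟩ : ∃ θ, τ = θ * γ.l := ⟨τ / γ.l, by field_simp⟩
  rw [mul_div_cancel_right₀ _ hl.ne'] at hcn
  have hθ : 0 < θ := pos_of_mul_pos_left hτ hl.le
  refine abs_le_of_sq_le_sq' (le_of_mul_le_mul_left ?_ hθ) dist_nonneg |>.2
  nlinarith

/-- Example 4.9: for `f = dist(·, C)` on a complete, locally compact `CAT(0)` space with
the geodesic extension property, `C` nonempty convex closed: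
`∂f(x) = {([γ],1) : γ ∈ Γ_x}` if `x ∉ C` (where `Γ_x` consists of the geodesics issuing
at `x` that extend the geodesic from `P_C(x)` through `x`);
`∂f(x) = {([γ],r) ∈ N_C(x) : r ∈ [0,1]}` if `x` is a boundary point of `C`; and
`∂f(x) = {o_x}` if `x` is an interior point of `C`. -/
theorem statement11 {X : Type*} [MetricSpace X] [CompleteSpace X] [LocallyCompactSpace X]
    (hcat : IsCAT0 X) (hext : GeodExtGlobal X)
    (C : Set X) (hCne : C.Nonempty) (hCconv : GConvex C) (hCcl : IsClosed C)
    (x : X) (γ : Geodesic X) (r : ℝ) (hT : InTangent x γ r) :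
    (x ∉ C →
      (IsSubgrad0 (fun y => ((Metric.infDist y C : ℝ) : EReal)) x γ r ↔
        r = 1 ∧ ∀ p ∈ projSet C x, dist p x + γ.l = dist p (γ.map γ.l))) ∧
    (x ∈ frontier C →
      (IsSubgrad0 (fun y => ((Metric.infDist y C : ℝ) : EReal)) x γ r ↔
        InNormalCone C x γ r ∧ r ≤ 1)) ∧
    (x ∈ interior C →
      (IsSubgrad0 (fun y => ((Metric.infDist y C : ℝ) : EReal)) x γ r ↔ r = 0)) := by
  obtain ⟨hγ, hr, hrl⟩ := hT
  have hγdist : ∀ t ∈ Set.Icc (0 : ℝ) γ.l, dist (γ.map t) x = t := fun t ht => by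
    rw [dist_comm, ← hγ, γ.isom 0 ⟨le_rfl, γ.l_nonneg⟩ t ht, zero_sub, abs_neg,
      abs_of_nonneg ht.1]
  have hzero : x ∈ C → r = 0 → IsSubgrad0 (fun y => ((infDist y C : ℝ) : EReal)) x γ r := by
    rintro hxC rfl
    refine (isSubgrad0_infDist_iff hcat hCne hCconv hCcl hγ hr).2 ⟨1, one_pos, ?_, ?_⟩
    · intro s hs t ht
      obtain rfl : s = 0 := le_antisymm (by simpa using hs.2) hs.1
      obtain rfl : t = 0 := le_antisymm (by simpa using ht.2) ht.1
      simp
    · intro y b hb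
      rw [infDist_zero_of_mem hxC]
      nlinarith [sq_nonneg (dist (γ.map (0 * 1)) y), infDist_nonneg.trans hb]
  rw [isSubgrad0_infDist_iff hcat hCne hCconv hCcl hγ hr] at hzero ⊢
  refine ⟨fun hxC => ⟨?_, ?_⟩, fun hxC => ⟨?_, ?_⟩, fun hxC => ⟨?_, ?_⟩⟩
  · rintro ⟨τ, hτ, hiso, hvar⟩
    have hr1 := le_one_of_variational hγ hr hτ hiso hvar
    have h0 : 0 ≤ r * τ := by positivity
    have hxq : dist (γ.map (r * τ)) x = r * τ := by
      rw [dist_comm, ← hγ, hiso 0 ⟨le_rfl, h0⟩ _ ⟨h0, le_rfl⟩, zero_sub, abs_neg,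
        abs_of_nonneg h0]
    have hkey := fun p (hp : p ∈ projSet C x) => dist_sq_ge_of_variational hcat hxq hvar hp
    obtain rfl : r = 1 := by
      obtain ⟨p, hp⟩ := hCconv.exists_mem_projSet hcat hCne hCcl x
      have ha : 0 < dist x p := dist_pos.2 fun h => hxC (h ▸ hp.1)
      have htri := pow_le_pow_left₀ dist_nonneg (dist_triangle (γ.map (r * τ)) x p) 2
      rw [hxq] at htri
      have h1 : 0 ≤ (dist x p * τ) * (r - 1) := by nlinarith [hkey p hp]
      have h2 := nonneg_of_mul_nonneg_right h1 (by positivity)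
      linarith
    rw [one_mul] at *
    have hl : 0 < γ.l := hrl.resolve_left one_ne_zero
    refine ⟨rfl, fun p hp => le_antisymm ?_ ?_⟩
    · have hq : dist p x + τ ≤ dist p (γ.map τ) := by
        rw [dist_comm p x, dist_comm p]
        exact abs_le_of_sq_le_sq' (by nlinarith [hkey p hp]) dist_nonneg |>.2
      rcases le_total τ γ.l with h | h
      · simpa only [hγ] using hcat.dist_add_le_of_dist_add_le γ hτ h (by rwa [hγ])
      · have hlq := hiso γ.l ⟨hl.le, h⟩ τ ⟨hτ.le, le_rfl⟩
        rw [abs_of_nonpos (by linarith)] at hlq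
        linarith [dist_triangle p (γ.map γ.l) (γ.map τ)]
    · have := hγdist γ.l ⟨hl.le, le_rfl⟩
      linarith [dist_triangle p x (γ.map γ.l), dist_comm x (γ.map γ.l)]
  · rintro ⟨rfl, hp⟩
    obtain ⟨p, hpC⟩ := hCconv.exists_mem_projSet hcat hCne hCcl x
    have hl : 0 < γ.l := hrl.resolve_left one_ne_zero
    have ha : 0 < dist x p := dist_pos.2 fun h => hxC (h ▸ hpC.1)
    have hpq := hp p hpC
    have hfx := infDist_eq_of_mem_projSet hpC
    have hxl := hγdist γ.l ⟨hl.le, le_rfl⟩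
    have hfq : dist x p + γ.l ≤ infDist (γ.map γ.l) C := by
      have hθ : dist x p / (dist x p + γ.l) ∈ Set.Icc (0 : ℝ) 1 :=
        ⟨by positivity, (div_le_one (by positivity)).2 (by linarith)⟩
      have h := hCconv.infDist_between_le hcat hCne hCcl (x := p) (y := γ.map γ.l) (m := x) hθ
        (by rw [← hpq, dist_comm p x]; field_simp)
        (by rw [← hpq, dist_comm p x, dist_comm, hxl]; field_simp; ring)
      rw [infDist_zero_of_mem hpC.1, hfx, mul_zero, zero_add, div_mul_eq_mul_div,
        le_div_iff₀ (by positivity)] at h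
      exact le_of_mul_le_mul_left h ha
    refine ⟨γ.l, hl, by simpa only [one_mul] using γ.isom, fun y b hb => ?_⟩
    rw [one_mul, hfx]
    have hlip : infDist (γ.map γ.l) C ≤ infDist y C + dist (γ.map γ.l) y :=
      infDist_le_infDist_add_dist
    nlinarith [sq_nonneg (dist (γ.map γ.l) y - (b - dist x p + γ.l))]
  · rintro ⟨τ, hτ, hiso, hvar⟩
    refine ⟨?_, le_one_of_variational hγ hr hτ hiso hvar⟩
    rcases hrl with hr0 | hl
    · exact Or.inl hr0
    rcases hr.eq_or_lt with hr0 | hr0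
    · exact Or.inl hr0.symm
    have ht : 0 < min γ.l (r * τ) := lt_min hl (by positivity)
    exact Or.inr ⟨_, ht, min_le_left _ _, hCconv.projSet_eq_singleton hcat
      (mem_projSet_of_variational hγ (hCcl.frontier_subset hxC) hiso hvar
        ⟨ht.le, min_le_right _ _⟩)⟩
  · have hxC' := hCcl.frontier_subset hxC
    rintro ⟨hr0 | ⟨t, ht, htl, hproj⟩, hr1⟩
    · exact hzero hxC' hr0
    rcases hr.eq_or_lt with hr0 | hr0
    · exact hzero hxC' hr0.symm
    obtain ⟨τ, rfl⟩ : ∃ τ, t = r * τ := ⟨t / r, by field_simp⟩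
    have hτ : 0 < τ := pos_of_mul_pos_right ht hr
    have hiso : ∀ s ∈ Set.Icc (0 : ℝ) (r * τ), ∀ t ∈ Set.Icc (0 : ℝ) (r * τ),
        dist (γ.map s) (γ.map t) = |s - t| := fun s hs t ht =>
      γ.isom s ⟨hs.1, hs.2.trans htl⟩ t ⟨ht.1, ht.2.trans htl⟩
    refine ⟨τ, hτ, hiso, fun y b hb => ?_⟩
    have hfq := infDist_eq_of_mem_projSet (hproj ▸ Set.mem_singleton x :
      x ∈ projSet C (γ.map (r * τ)))
    rw [hγdist _ ⟨ht.le, htl⟩] at hfq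
    have hlip : infDist (γ.map (r * τ)) C ≤ infDist y C + dist (γ.map (r * τ)) y :=
      infDist_le_infDist_add_dist
    rw [infDist_zero_of_mem hxC', sub_zero]
    have hb0 : 0 ≤ b := infDist_nonneg.trans hb
    have hu0 : 0 ≤ dist (γ.map (r * τ)) y := dist_nonneg
    set u := dist (γ.map (r * τ)) y
    rcases le_total (r * τ) u with h | h
    · nlinarith
    · have hrτ : r * τ ≤ τ := mul_le_of_le_one_left hτ.le hr1
      have hv : (τ + r * τ - u) ^ 2 ≤ (b + τ) ^ 2 :=
        pow_le_pow_left₀ (by linarith) (by linarith) 2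
      nlinarith [mul_nonneg (sub_nonneg.2 h) (by linarith : 0 ≤ τ - u)]
  · rintro ⟨τ, hτ, hiso, hvar⟩
    by_contra hr0
    have hrpos : 0 < r * τ := mul_pos (lt_of_le_of_ne hr (Ne.symm hr0)) hτ
    obtain ⟨ε, hε, hball⟩ := Metric.mem_nhds_iff.1 (mem_interior_iff_mem_nhds.1 hxC)
    set u := min (ε / 2) (r * τ) with hu
    have hu0 : 0 < u := lt_min (by positivity) hrpos
    have huI : u ∈ Set.Icc (0 : ℝ) (r * τ) := ⟨hu0.le, min_le_right _ _⟩
    have hux : dist (γ.map u) x = u := by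
      rw [dist_comm, ← hγ, hiso 0 ⟨le_rfl, hrpos.le⟩ u huI, zero_sub, abs_neg, abs_of_nonneg hu0.le]
    have hle := (mem_projSet_of_variational hγ (interior_subset hxC) hiso hvar huI).2 (γ.map u)
      (hball (by rw [Metric.mem_ball, hux]; linarith [min_le_left (ε / 2) (r * τ)]))
    rw [hux, dist_self] at hle
    linarith
  · exact hzero (interior_subset hxC)

end CATPaper
end
end
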